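/- arXiv:2203.04630 — 4 statements merged into one kernel-verified Lean document; each statement's English description precedes it below -/
import Mathlib

section
/- Let 𝔖 be a split system on a finite multiset 𝓜 of size n ≥ 3 such that every proper submultiset of 𝔖 is compatible. If there is a split S = A|Ā ∈ 𝔖 such that every element of A has multiplicity 1 in 𝓜 (that is, A ⊆ 𝓜*), then 𝔖 is compatible. -/
open scoped Classical

/-- A split of a multiset `M`: an unordered pair of nonempty submultisets of `M`
whose multiset union is `M`. -/
def IsSplit {X : Type} (M : Multiset X) (S : Sym2 (Multiset X)) : Prop :=
  ∃ A B : Multiset X, S = s(A, B) ∧ A ≠ 0 ∧ B ≠ 0 ∧ A + B = M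

/-- A split system on `M`: a multiset of splits of `M`. -/
def IsSplitSystem {X : Type} (M : Multiset X) (𝔖 : Multiset (Sym2 (Multiset X))) : Prop :=
  ∀ S ∈ 𝔖, IsSplit M S

/-- An `M`-tree: a finite tree whose vertices are labelled by submultisets of `M`
such that (M1) the multiset union of all labels is `M`, and (M2) every vertex of
degree 1 or 2 has a nonempty label. -/
structure MTree (X : Type) (M : Multiset X) where
  n : ℕ
  G : SimpleGraph (Fin n)
  connected : G.Connected
  acyclic : G.IsAcyclic
  label : Fin n → Multiset X
  m1 : ∑ v, label v = M
  m2 : ∀ v, G.degree v = 1 ∨ G.degree v = 2 → label v ≠ 0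

namespace MTree

variable {X : Type} {M : Multiset X}

/-- The part of the split induced by the edge `{u, v}` lying on the side of `u`:
the multiset union of the labels of the vertices in the connected component of `u`
after deleting the edge `{u, v}`. -/
noncomputable def part (T : MTree X M) (u v : Fin T.n) : Multiset X :=
  ∑ w ∈ Finset.univ.filter (fun w => (T.G.deleteEdges {s(u, v)}).Reachable u w), T.label w

/-- The multiset of splits represented by an `M`-tree: the splits induced by its edges. -/
noncomputable def splits (T : MTree X M) : Multiset (Sym2 (Multiset X)) :=
  T.G.edgeFinset.val.map
    (Sym2.lift ⟨fun u v => s(T.part u v, T.part v u), fun u v => Sym2.eq_swap⟩)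

end MTree

/-- A split system on `M` is compatible if some `M`-tree represents it. -/
def Compatible {X : Type} (M : Multiset X) (𝔖 : Multiset (Sym2 (Multiset X))) : Prop :=
  ∃ T : MTree X M, T.splits = 𝔖

/-- `Δ(M) = Σ_{x ∈ X} (M(x) - 1)`. -/
def delta {X : Type} [DecidableEq X] (M : Multiset X) : ℕ :=
  ∑ x ∈ M.toFinset, (M.count x - 1)

/-- The split system `{S₁, …, Sₙ}` determined by an indexed family of ordered splits,
where split `i` has parts `P i true` and `P i false`. -/
def splitSystemOf {X : Type} {n : ℕ} (P : Fin n → Bool → Multiset X) :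
    Multiset (Sym2 (Multiset X)) :=
  (Finset.univ.val : Multiset (Fin n)).map fun i => s(P i true, P i false)

/-- The arcs of the split-containment graph `Γ(𝔖)`: its vertices are the pairs
`(i, b)` (representing the pair `(P i b, Sᵢ)` of a part of the split `Sᵢ` together
with `Sᵢ`), and there is an arc from `(i, b)` to `(j, c)` iff `i ≠ j` and
`P i b ⊊ P j c` as multisets. -/
def GammaArc {X : Type} {n : ℕ} (P : Fin n → Bool → Multiset X)
    (u v : Fin n × Bool) : Prop :=
  u.1 ≠ v.1 ∧ P u.1 u.2 < P v.1 v.2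

/-- A thin subgraph of `Γ(𝔖)`: a spanning subgraph `G` of `Γ(𝔖)` such that for all
distinct `i, j` the restriction of `G` to the four vertices coming from `Sᵢ` and `Sⱼ`
has exactly two arcs, of the form `((C,Sᵢ),(D,Sⱼ))` and `((D̄,Sⱼ),(C̄,Sᵢ))`. -/
def IsThinSubgraph {X : Type} {n : ℕ} (P : Fin n → Bool → Multiset X)
    (G : Fin n × Bool → Fin n × Bool → Prop) : Prop :=
  (∀ u v, G u v → GammaArc P u v) ∧
  ∀ i j : Fin n, i ≠ j → ∃ b c : Bool, ∀ b' c' : Bool,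
    (G (i, b') (j, c') ↔ b' = b ∧ c' = c) ∧
    (G (j, c') (i, b') ↔ c' = !c ∧ b' = !b)

/-- An arc `(u, v)` of a digraph `G` is critical if the only directed path in `G`
from `u` to `v` is the arc itself. -/
def IsCriticalArc {V : Type} (G : V → V → Prop) (u v : V) : Prop :=
  G u v ∧ ¬ ∃ w, G u w ∧ w ≠ v ∧ Relation.TransGen G w v

/-- A (thin) subgraph `G` of `Γ(𝔖)` is consistent if for every vertex `(A, Sᵢ)` of `G`,
the multiset union of the parts `B` over all vertices `(B, Sⱼ)` such that
`((B,Sⱼ),(A,Sᵢ))` is a critical arc of `G` is a submultiset of `A`. -/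
def IsConsistent {X : Type} {n : ℕ} (P : Fin n → Bool → Multiset X)
    (G : Fin n × Bool → Fin n × Bool → Prop) : Prop :=
  ∀ u : Fin n × Bool,
    (∑ w ∈ Finset.univ.filter (fun w => IsCriticalArc G w u), P w.1 w.2) ≤ P u.1 u.2

/-- A part `A` of a split `A|Ā ∈ 𝔖` is a terminal set of `𝔖` if for every split
`B|B̄` of `𝔖` other than (this occurrence of) `A|Ā`, neither `B ⊊ A` nor `B̄ ⊊ A`. -/
def IsTerminal {X : Type} [DecidableEq X] (M : Multiset X)
    (𝔖 : Multiset (Sym2 (Multiset X))) (A : Multiset X) : Prop :=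
  s(A, M - A) ∈ 𝔖 ∧ ∀ T ∈ 𝔖.erase s(A, M - A), ∀ B ∈ T, ¬ B < A

/-- A terminal set `A` of `𝔖` is a superterminal set if in addition, for every split
`B|B̄` of `𝔖` other than `A|Ā`, exactly one of `A ⊊ B`, `A ⊊ B̄` holds. -/
def IsSuperterminal {X : Type} [DecidableEq X] (M : Multiset X)
    (𝔖 : Multiset (Sym2 (Multiset X))) (A : Multiset X) : Prop :=
  IsTerminal M 𝔖 A ∧
    ∀ T ∈ 𝔖.erase s(A, M - A), ∀ B C : Multiset X, T = s(B, C) → (A < B ↔ ¬ A < C)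

/-- Two splits are compatible if they have parts `A ∈ S₁`, `B ∈ S₂` with `A ∩ B = ∅`
(multiset intersection). -/
def SplitPairCompatible {X : Type} [DecidableEq X] (S₁ S₂ : Sym2 (Multiset X)) : Prop :=
  ∃ A ∈ S₁, ∃ B ∈ S₂, A ∩ B = 0

/-- A split system is pairwise compatible if any two of its splits are compatible. -/
def PairwiseCompatible {X : Type} [DecidableEq X] (𝔖 : Multiset (Sym2 (Multiset X))) : Prop :=
  ∀ S₁ ∈ 𝔖, ∀ S₂ ∈ 𝔖.erase S₁, SplitPairCompatible S₁ S₂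

/-- The size of a split `A|B` is `min {|A|, |B|}`. -/
def splitSize {X : Type} : Sym2 (Multiset X) → ℕ :=
  Sym2.lift ⟨fun A B => min A.card B.card, fun A B => min_comm _ _⟩

/-- Isomorphism of `M`-trees: a graph isomorphism preserving the labels. -/
def MTreeIso {X : Type} {M : Multiset X} (T T' : MTree X M) : Prop :=
  ∃ φ : Fin T.n ≃ Fin T'.n,
    (∀ u v, T.G.Adj u v ↔ T'.G.Adj (φ u) (φ v)) ∧ ∀ v, T'.label (φ v) = T.label v

/-- Isomorphism of digraphs. -/
def DigraphIso {V W : Type} (R : V → V → Prop) (Q : W → W → Prop) : Prop :=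
  ∃ φ : V ≃ W, ∀ a b, R a b ↔ Q (φ a) (φ b)

/-- The digraph `D₁` on the four vertices `v = 0`, `w = 1`, `p = 2`, `q = 3`,
with arcs `(v,p)` and `(q,w)`. -/
def D1 : Fin 4 → Fin 4 → Prop := fun a b => (a = 0 ∧ b = 2) ∨ (a = 3 ∧ b = 1)

/-- The digraph `D₂` on the four vertices `v = 0`, `w = 1`, `p = 2`, `q = 3`,
with arcs `(v,p)`, `(p,w)`, `(v,q)` and `(q,w)`. -/
def D2 : Fin 4 → Fin 4 → Prop :=
  fun a b => (a = 0 ∧ b = 2) ∨ (a = 2 ∧ b = 1) ∨ (a = 0 ∧ b = 3) ∨ (a = 3 ∧ b = 1)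

/-- Isomorphism of subgraphs of `Γ(𝔖)`: a digraph isomorphism mapping each vertex
`(A, Sᵢ)` to a vertex `(B, Sⱼ)` with `A = B`. -/
def SubgraphIso {X : Type} {n : ℕ} (P : Fin n → Bool → Multiset X)
    (G G' : Fin n × Bool → Fin n × Bool → Prop) : Prop :=
  ∃ φ : Fin n × Bool ≃ Fin n × Bool,
    (∀ u v, G u v ↔ G' (φ u) (φ v)) ∧ ∀ u, P (φ u).1 (φ u).2 = P u.1 u.2

namespace SimpleGraph

variable {V : Type*} {G : SimpleGraph V} {u v w : V}

lemma Reachable.mem_of_closed {P : V → Prop} (h : G.Reachable u w) (hu : P u)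
    (hP : ∀ a b, G.Adj a b → P a → P b) : P w := by
  obtain ⟨p⟩ := h
  induction p with
  | nil => exact hu
  | cons hadj _ ih => exact ih (hP _ _ hadj hu)

lemma Connected.reachable_deleteEdges_or (hG : G.Connected) (u v w : V) :
    (G.deleteEdges {s(u, v)}).Reachable u w ∨ (G.deleteEdges {s(u, v)}).Reachable v w := by
  refine (hG.preconnected u w).mem_of_closed (P := fun w =>
    (G.deleteEdges {s(u, v)}).Reachable u w ∨ (G.deleteEdges {s(u, v)}).Reachable v w)
    (.inl .rfl) fun a b hab h => ?_
  by_cases he : s(a, b) = s(u, v)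
  · rcases Sym2.eq_iff.1 he with ⟨rfl, rfl⟩ | ⟨rfl, rfl⟩
    · exact .inr .rfl
    · exact .inl .rfl
  · have hab' : (G.deleteEdges {s(u, v)}).Adj a b := by simpa using ⟨hab, by simpa using he⟩
    exact h.imp (·.trans hab'.reachable) (·.trans hab'.reachable)

/-- If `{u, v}` is the only edge leaving `P`, then `P` is the side of `u` after deleting it. -/
lemma Connected.reachable_deleteEdges_iff (hG : G.Connected) {P : V → Prop} (hu : P u)
    (hv : ¬ P v) (hP : ∀ a b, G.Adj a b → P a → ¬ P b → s(a, b) = s(u, v)) (w : V) :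
    (G.deleteEdges {s(u, v)}).Reachable u w ↔ P w := by
  refine ⟨fun h => h.mem_of_closed hu fun a b hab ha => ?_, fun hw => ?_⟩
  · by_contra hb
    rw [deleteEdges_adj] at hab
    exact hab.2 (hP a b hab.1 ha hb)
  · refine (hG.reachable_deleteEdges_or u v w).resolve_right fun h => ?_
    refine h.mem_of_closed (P := fun w => ¬ P w) hv (fun a b hab ha hb => ?_) hw
    rw [deleteEdges_adj] at hab
    exact hab.2 (Sym2.eq_swap.trans (hP b a hab.1.symm hb ha))

lemma IsAcyclic.not_reachable_deleteEdges (hG : G.IsAcyclic) (h : G.Adj u v) :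
    ¬ (G.deleteEdges {s(u, v)}).Reachable u v :=
  isBridge_iff.1 (isAcyclic_iff_forall_adj_isBridge.1 hG h)

lemma Connected.exists_adj_reachable_deleteEdges (hG : G.Connected) (h : u ≠ w) :
    ∃ v, G.Adj u v ∧ (G.deleteEdges {s(u, v)}).Reachable v w := by
  obtain ⟨p, hp⟩ := (hG.preconnected u w).exists_isPath
  cases p with
  | nil => exact absurd rfl h
  | @cons _ v _ hadj q =>
    refine ⟨v, hadj, ⟨q.toDeleteEdges _ fun e he he' => ?_⟩⟩
    rw [Set.mem_singleton_iff] at he'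
    subst he'
    exact ((Walk.cons_isPath_iff _ _).1 hp).2 (q.fst_mem_support_of_mem_edges he)

/-- The graph obtained from `G` by attaching a new leaf `Fin.last n` to the vertex `v`. -/
def addLeaf {n : ℕ} (G : SimpleGraph (Fin n)) (v : Fin n) : SimpleGraph (Fin (n + 1)) :=
  G.map Fin.castSuccEmb ⊔ edge v.castSucc (Fin.last n)

section addLeaf

variable {n : ℕ} {G : SimpleGraph (Fin n)} {v a b : Fin n}

@[simp]
lemma addLeaf_adj_castSucc : (G.addLeaf v).Adj a.castSucc b.castSucc ↔ G.Adj a b := by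
  have := SimpleGraph.map_adj_apply (G := G) (f := Fin.castSuccEmb) (a := a) (b := b)
  simp only [Fin.coe_castSuccEmb] at this
  simp [addLeaf, edge_adj, this, Fin.castSucc_ne_last]

@[simp]
lemma addLeaf_adj_castSucc_last : (G.addLeaf v).Adj a.castSucc (Fin.last n) ↔ a = v := by
  have h : ¬ (G.map Fin.castSuccEmb).Adj a.castSucc (Fin.last n) := by
    rw [map_adj]
    simp [Fin.castSucc_ne_last]
  rw [Fin.coe_castSuccEmb] at h
  simp [addLeaf, edge_adj, h, Fin.castSucc_ne_last]

@[simp]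
lemma addLeaf_adj_last_castSucc : (G.addLeaf v).Adj (Fin.last n) a.castSucc ↔ a = v := by
  rw [adj_comm, addLeaf_adj_castSucc_last]

lemma addLeaf_edgeSet (G : SimpleGraph (Fin n)) (v : Fin n) :
    (G.addLeaf v).edgeSet =
      insert s(v.castSucc, Fin.last n) (Sym2.map Fin.castSucc '' G.edgeSet) := by
  rw [addLeaf, edgeSet_sup, edgeSet_edge_of_ne (Fin.castSucc_ne_last v), edgeSet_map,
    Set.union_comm]
  rfl

lemma addLeaf_connected (hG : G.Connected) (v : Fin n) : (G.addLeaf v).Connected := by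
  rw [connected_iff_exists_forall_reachable]
  refine ⟨v.castSucc, fun w => ?_⟩
  induction w using Fin.lastCases with
  | last => exact Adj.reachable (by simp)
  | cast w =>
    exact (hG.preconnected v w).map ⟨Fin.castSucc, fun h => addLeaf_adj_castSucc.2 h⟩

/-- The side of `a` on deleting an edge `{a, b}` of `G` from `G.addLeaf v`. -/
lemma addLeaf_reachable_deleteEdges_iff (hG : G.Connected) (hG' : G.IsAcyclic) (hab : G.Adj a b)
    (w : Fin (n + 1)) :
    ((G.addLeaf v).deleteEdges {s(a.castSucc, b.castSucc)}).Reachable a.castSucc w ↔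
      Fin.lastCases (motive := fun _ => Prop) ((G.deleteEdges {s(a, b)}).Reachable a v)
        (fun w => (G.deleteEdges {s(a, b)}).Reachable a w) w := by
  apply (addLeaf_connected hG v).reachable_deleteEdges_iff
  · simp
  · simpa using hG'.not_reachable_deleteEdges hab
  · intro c d hcd hc hd
    induction c using Fin.lastCases with
    | last =>
      induction d using Fin.lastCases with
      | last => simp at hcd
      | cast d => simp_all
    | cast c =>
      induction d using Fin.lastCases with
      | last => simp_all
      | cast d =>
        simp only [Fin.lastCases_castSucc, addLeaf_adj_castSucc] at hc hd hcd
        have : s(c, d) = s(a, b) := by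
          by_contra hne
          exact hd (hc.trans (Adj.reachable (by simpa using ⟨hcd, by simpa using hne⟩)))
        simpa using congrArg (Sym2.map Fin.castSucc) this

/-- The new leaf is alone on its side. -/
lemma addLeaf_reachable_last_iff (hG : G.Connected) (w : Fin (n + 1)) :
    ((G.addLeaf v).deleteEdges {s(Fin.last n, v.castSucc)}).Reachable (Fin.last n) w ↔
      w = Fin.last n := by
  apply (addLeaf_connected hG v).reachable_deleteEdges_iff (P := fun w => w = Fin.last n)
  · rfl
  · exact Fin.castSucc_ne_last v
  · rintro c d hcd rfl hd
    induction d using Fin.lastCases with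
    | last => simp at hd
    | cast d => simp_all

lemma addLeaf_isAcyclic (hG : G.Connected) (hG' : G.IsAcyclic) (v : Fin n) :
    (G.addLeaf v).IsAcyclic := by
  rw [isAcyclic_iff_forall_isBridge]
  intro e he
  rw [addLeaf_edgeSet] at he
  rcases he with rfl | ⟨e, he, rfl⟩
  · rw [Sym2.eq_swap, isBridge_iff, addLeaf_reachable_last_iff hG]
    exact Fin.castSucc_ne_last v
  · induction e with | _ a b
    rw [Sym2.map_mk, isBridge_iff, addLeaf_reachable_deleteEdges_iff hG hG' he]
    simpa using hG'.not_reachable_deleteEdges he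

open scoped Classical in
lemma addLeaf_degree_castSucc (G : SimpleGraph (Fin n)) (v w : Fin n) :
    (G.addLeaf v).degree w.castSucc = G.degree w + if w = v then 1 else 0 := by
  simp only [← card_neighborFinset_eq_degree, neighborFinset_eq_filter, Finset.card_filter]
  rw [Fin.sum_univ_castSucc]
  simp

end addLeaf

section sidePart

open scoped Classical

variable {X V : Type*} [Fintype V] {G : SimpleGraph V} {ℓ : V → Multiset X} {u v w : V}

/-- The union of the labels on the side of `u` after deleting the edge `{u, v}`. -/
noncomputable def sidePart (G : SimpleGraph V) (ℓ : V → Multiset X) (u v : V) : Multiset X :=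
  ∑ w ∈ Finset.univ.filter (fun w => (G.deleteEdges {s(u, v)}).Reachable u w), ℓ w

/-- The split induced by an edge of a labelled graph. -/
noncomputable def edgeSplit (G : SimpleGraph V) (ℓ : V → Multiset X) :
    Sym2 V → Sym2 (Multiset X) :=
  Sym2.lift ⟨fun u v => s(G.sidePart ℓ u v, G.sidePart ℓ v u), fun _ _ => Sym2.eq_swap⟩

@[simp]
lemma edgeSplit_mk (G : SimpleGraph V) (ℓ : V → Multiset X) (u v : V) :
    G.edgeSplit ℓ s(u, v) = s(G.sidePart ℓ u v, G.sidePart ℓ v u) := rfl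

lemma Connected.sidePart_eq (hG : G.Connected) {P : V → Prop} (hu : P u) (hv : ¬ P v)
    (hP : ∀ a b, G.Adj a b → P a → ¬ P b → s(a, b) = s(u, v)) :
    G.sidePart ℓ u v = ∑ w ∈ Finset.univ.filter P, ℓ w := by
  simp only [sidePart, hG.reachable_deleteEdges_iff hu hv hP]

lemma Connected.sidePart_eq_label (hG : G.Connected) (huv : u ≠ v)
    (h : ∀ w, G.Adj u w → w = v) : G.sidePart ℓ u v = ℓ u := by
  rw [hG.sidePart_eq (P := (· = u)) rfl huv.symm]
  · rw [Finset.sum_filter, Finset.sum_ite_eq' Finset.univ u, if_pos (Finset.mem_univ u)]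
  · rintro u' w hw rfl -
    rw [h w hw]

lemma IsTree.sidePart_add_sidePart (hG : G.IsTree) (h : G.Adj u v) :
    G.sidePart ℓ u v + G.sidePart ℓ v u = ∑ w, ℓ w := by
  rw [sidePart, sidePart, ← Finset.sum_filter_add_sum_filter_not Finset.univ
      (fun w => (G.deleteEdges {s(u, v)}).Reachable u w)]
  congr 2
  ext w
  simp only [Finset.mem_filter, Finset.mem_univ, true_and, Sym2.eq_swap (a := v) (b := u)]
  exact ⟨fun hv hu => hG.isAcyclic.not_reachable_deleteEdges h (hu.trans hv.symm),
    (hG.connected.reachable_deleteEdges_or u v w).resolve_left⟩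

lemma label_le_sidePart (h : (G.deleteEdges {s(u, v)}).Reachable u w) :
    ℓ w ≤ G.sidePart ℓ u v :=
  Finset.single_le_sum (f := ℓ) (fun _ _ => zero_le) (by simpa using h)

/-- A nonempty set of elements of multiplicity one that is separated by no edge of the tree is
contained in a vertex label. -/
lemma IsTree.exists_le_label (hG : G.IsTree) {A : Multiset X} (hA0 : A ≠ 0)
    (hA : ∀ x ∈ A, (∑ v, ℓ v).count x = 1) (hAM : A ≤ ∑ v, ℓ v)
    (hsplit : ∀ u v, G.Adj u v → A ≤ G.sidePart ℓ u v ∨ A ≤ G.sidePart ℓ v u) :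
    ∃ v, A ≤ ℓ v := by
  have hmem : ∀ x ∈ A, ∃ v, x ∈ ℓ v := fun x hx => by
    simpa [Multiset.mem_sum] using Multiset.mem_of_le hAM hx
  obtain ⟨x, hx⟩ := Multiset.exists_mem_of_ne_zero hA0
  obtain ⟨v, hv⟩ := hmem x hx
  have hnd : A.Nodup := Multiset.nodup_iff_count_le_one.2 fun y => by
    by_cases hy : y ∈ A
    · exact (Multiset.count_le_of_le y hAM).trans (hA y hy).le
    · simp [hy]
  refine ⟨v, (Multiset.le_iff_subset hnd).2 fun y hy => ?_⟩
  obtain ⟨w, hw⟩ := hmem y hy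
  by_cases hvw : v = w
  · rwa [hvw]
  obtain ⟨v', hadj, hr⟩ := hG.connected.exists_adj_reachable_deleteEdges hvw
  have hxp : x ∈ G.sidePart ℓ v v' := Multiset.mem_of_le (label_le_sidePart .rfl) hv
  have hyp : y ∈ G.sidePart ℓ v' v :=
    Multiset.mem_of_le (label_le_sidePart (by rwa [Sym2.eq_swap])) hw
  have key : ∀ z ∈ A, z ∈ G.sidePart ℓ v v' → z ∉ G.sidePart ℓ v' v := fun z hz h₁ h₂ => by
    have h := hA z hz
    rw [← hG.sidePart_add_sidePart hadj, Multiset.count_add] at h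
    have := Multiset.count_pos.2 h₁
    have := Multiset.count_pos.2 h₂
    lia
  rcases hsplit _ _ hadj with hAC | hAC
  · exact absurd hyp (key y hy (Multiset.mem_of_le hAC hy))
  · exact absurd (Multiset.mem_of_le hAC hx) (key x hx hxp)

end sidePart

section addLeafLabel

open scoped Classical

variable {X : Type*} {n : ℕ} {G : SimpleGraph (Fin n)} {ℓ : Fin n → Multiset X}
  {v a b : Fin n} {A : Multiset X}

/-- The labelling of `G.addLeaf v` obtained by moving the part `A` of the label of `v` to the new
leaf. -/
noncomputable def addLeafLabel (ℓ : Fin n → Multiset X) (v : Fin n) (A : Multiset X) :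
    Fin (n + 1) → Multiset X :=
  Fin.lastCases A fun w => if w = v then ℓ v - A else ℓ w

@[simp]
lemma addLeafLabel_last : addLeafLabel ℓ v A (Fin.last n) = A := by simp [addLeafLabel]

lemma addLeafLabel_castSucc (w : Fin n) :
    addLeafLabel ℓ v A w.castSucc = if w = v then ℓ v - A else ℓ w := by simp [addLeafLabel]

lemma addLeafLabel_castSucc_add (hA : A ≤ ℓ v) (w : Fin n) :
    addLeafLabel ℓ v A w.castSucc + (if w = v then A else 0) = ℓ w := by
  rw [addLeafLabel_castSucc]
  split_ifs with h
  · rw [h, Multiset.sub_add_cancel hA]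
  · simp

lemma sum_addLeafLabel (hA : A ≤ ℓ v) : ∑ w, addLeafLabel ℓ v A w = ∑ w, ℓ w := by
  simp only [← addLeafLabel_castSucc_add hA, Finset.sum_add_distrib]
  simp [Fin.sum_univ_castSucc]

lemma IsTree.sidePart_addLeaf (hG : G.IsTree) (hA : A ≤ ℓ v) (hab : G.Adj a b) :
    (G.addLeaf v).sidePart (addLeafLabel ℓ v A) a.castSucc b.castSucc = G.sidePart ℓ a b := by
  have h : ∀ w, (if (G.deleteEdges {s(a, b)}).Reachable a w then ℓ w else 0) =
      (if (G.deleteEdges {s(a, b)}).Reachable a w then addLeafLabel ℓ v A w.castSucc else 0) +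
        if w = v then (if (G.deleteEdges {s(a, b)}).Reachable a v then A else 0) else 0 :=
    fun w => by
      rw [← addLeafLabel_castSucc_add hA w]
      split_ifs <;> simp_all
  simp only [sidePart, addLeaf_reachable_deleteEdges_iff hG.connected hG.isAcyclic hab,
    Finset.sum_filter, Fin.sum_univ_castSucc]
  have h' := Finset.sum_congr (rfl : (Finset.univ : Finset (Fin n)) = _) fun w _ => h w
  rw [Finset.sum_add_distrib, Finset.sum_ite_eq' Finset.univ v, if_pos (Finset.mem_univ v)] at h'
  simp only [Fin.lastCases_castSucc, Fin.lastCases_last, addLeafLabel_last]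
  convert h'.symm

lemma IsTree.sidePart_addLeaf_last (hG : G.IsTree) :
    (G.addLeaf v).sidePart (addLeafLabel ℓ v A) (Fin.last n) v.castSucc = A := by
  simp [sidePart, addLeaf_reachable_last_iff hG.connected, Finset.filter_eq']

lemma IsTree.addLeaf (hG : G.IsTree) (v : Fin n) : (G.addLeaf v).IsTree :=
  ⟨addLeaf_connected hG.connected v, addLeaf_isAcyclic hG.connected hG.isAcyclic v⟩

lemma IsTree.edgeSplits_addLeaf (hG : G.IsTree) (hA : A ≤ ℓ v) {B : Multiset X}
    (hAB : A + B = ∑ w, ℓ w) :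
    (G.addLeaf v).edgeFinset.val.map ((G.addLeaf v).edgeSplit (addLeafLabel ℓ v A)) =
      s(A, B) ::ₘ G.edgeFinset.val.map (G.edgeSplit ℓ) := by
  have hB : (G.addLeaf v).sidePart (addLeafLabel ℓ v A) v.castSucc (Fin.last n) = B := by
    have h := (hG.addLeaf v).sidePart_add_sidePart (ℓ := addLeafLabel ℓ v A)
      (addLeaf_adj_last_castSucc.2 rfl)
    rw [hG.sidePart_addLeaf_last, sum_addLeafLabel hA, ← hAB] at h
    exact add_left_cancel h
  have hnot : s(Fin.last n, v.castSucc) ∉ G.edgeFinset.map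
      ⟨Sym2.map Fin.castSucc, Sym2.map.injective (Fin.castSucc_injective _)⟩ := by
    simp only [Finset.mem_map, not_exists, not_and]
    intro e _ he
    induction e with | _ a b
    simp [Fin.castSucc_ne_last] at he
  have hE : (G.addLeaf v).edgeFinset = Finset.cons s(Fin.last n, v.castSucc)
      (G.edgeFinset.map
        ⟨Sym2.map Fin.castSucc, Sym2.map.injective (Fin.castSucc_injective _)⟩) hnot := by
    rw [← Finset.coe_inj]
    simpa [Sym2.eq_swap] using addLeaf_edgeSet G v
  rw [hE, Finset.cons_val, Multiset.map_cons, Finset.map_val, Multiset.map_map, edgeSplit_mk,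
    hG.sidePart_addLeaf_last, hB]
  congr 1
  refine Multiset.map_congr rfl fun e he => ?_
  induction e with | _ a b
  have he : G.Adj a b := by simpa using he
  simp [hG.sidePart_addLeaf hA he, hG.sidePart_addLeaf hA he.symm]

end addLeafLabel

end SimpleGraph

/-- The splits of an `M`-tree in terms of its underlying labelled graph. -/
lemma MTree.splits_eq {X : Type} {M : Multiset X} (T : MTree X M) :
    T.splits = T.G.edgeFinset.val.map (T.G.edgeSplit T.label) := by
  have h : ∀ u v, T.part u v = T.G.sidePart T.label u v := fun u v => by
    rw [part, SimpleGraph.sidePart]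
    congr!
  simp only [splits, SimpleGraph.edgeSplit, h]

lemma Fin.exists_eq_of_ne_edges (u v x y : Fin 3) (huv : u ≠ v) (hxy : x ≠ y)
    (h : s(u, v) ≠ s(x, y)) : ∃ a b c : Fin 3, s(u, v) = s(a, b) ∧ s(x, y) = s(c, b) ∧
      a ≠ b ∧ a ≠ c ∧ b ≠ c ∧ ∀ w, w = a ∨ w = b ∨ w = c := by
  revert u v x y
  decide

open SimpleGraph in
/-- Two splits that are compatible are cut out by a partition of `M` into three nonempty parts. -/
lemma Compatible.exists_of_pair {X : Type} {M : Multiset X} {S T : Sym2 (Multiset X)}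
    (h : Compatible M {S, T}) : ∃ P Q R : Multiset X, P ≠ 0 ∧ Q ≠ 0 ∧ R ≠ 0 ∧
      P + Q + R = M ∧ S = s(P, Q + R) ∧ T = s(R, P + Q) := by
  obtain ⟨⟨n, G, hconn, hacyc, ℓ, rfl, m2⟩, h⟩ := h
  simp only [MTree.splits_eq] at h
  have htree : G.IsTree := ⟨hconn, hacyc⟩
  have hcard : Multiset.card G.edgeFinset.val = 2 := by
    simpa using congrArg Multiset.card h
  obtain rfl : n = 3 := by
    have := htree.card_edgeFinset
    simp only [Fintype.card_fin, Finset.card_def] at this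
    lia
  have hℓ : ∀ v, ℓ v ≠ 0 := fun v => m2 v (by
    have := hconn.preconnected.degree_pos_of_nontrivial v
    have := G.degree_lt_card_verts v
    simp only [Fintype.card_fin] at this
    lia)
  obtain ⟨e, f, hef, hST⟩ : ∃ e f, G.edgeFinset.val = {e, f} ∧
      G.edgeSplit ℓ e = S ∧ G.edgeSplit ℓ f = T := by
    obtain ⟨e, f, hef⟩ := Multiset.card_eq_two.1 hcard
    rw [hef] at h
    simp only [Multiset.insert_eq_cons, Multiset.map_cons, Multiset.map_singleton] at h
    rcases Multiset.cons_eq_cons.1 h with ⟨h₁, h₂⟩ | ⟨_, t, h₁, h₂⟩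
    · exact ⟨e, f, hef, h₁, Multiset.singleton_inj.1 h₂⟩
    · obtain rfl : t = 0 := by simpa using congrArg Multiset.card h₁
      refine ⟨f, e, by rw [hef, Multiset.pair_comm], ?_, ?_⟩
      · simpa using h₁
      · simpa [eq_comm] using h₂
  have hne : e ≠ f := by
    have := G.edgeFinset.nodup
    rw [hef] at this
    simpa using this
  have hadj : ∀ a b, G.Adj a b ↔ s(a, b) = e ∨ s(a, b) = f := fun a b => by
    rw [← mem_edgeSet, ← mem_edgeFinset, ← Finset.mem_val, hef]
    simp
  induction e with | _ u v
  induction f with | _ x y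
  have huv : u ≠ v := ((hadj u v).2 (.inl rfl)).ne
  have hxy : x ≠ y := ((hadj x y).2 (.inr rfl)).ne
  obtain ⟨a, b, c, h₁, h₂, hab, hac, hbc, hall⟩ := Fin.exists_eq_of_ne_edges u v x y huv hxy hne
  rw [h₁, h₂] at hadj
  rw [h₁, h₂] at hST
  have huniv : (Finset.univ : Finset (Fin 3)) = {a, b, c} := by
    ext w
    simpa using hall w
  have hsum : ∑ w, ℓ w = ℓ a + ℓ b + ℓ c := by
    rw [huniv, Finset.sum_insert (by simp [hab, hac]), Finset.sum_pair hbc, add_assoc]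
  have ha : G.sidePart ℓ a b = ℓ a := hconn.sidePart_eq_label hab fun w hw => by
    rw [hadj] at hw
    grind
  have hc : G.sidePart ℓ c b = ℓ c := hconn.sidePart_eq_label hbc.symm fun w hw => by
    rw [hadj] at hw
    grind
  have ha' := htree.sidePart_add_sidePart (ℓ := ℓ) ((hadj a b).2 (.inl rfl))
  have hc' := htree.sidePart_add_sidePart (ℓ := ℓ) ((hadj c b).2 (.inr rfl))
  rw [ha, hsum, add_assoc] at ha'
  rw [hc, hsum, add_comm] at hc'
  refine ⟨ℓ a, ℓ b, ℓ c, hℓ a, hℓ b, hℓ c, hsum.symm, ?_, ?_⟩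
  · rw [← hST.1, edgeSplit_mk, ha, add_left_cancel ha']
  · rw [← hST.2, edgeSplit_mk, hc, add_right_cancel hc']

open SimpleGraph in
/-- A compatible nonempty split system can be extended by a new split `A|B` if `A` consists of
elements of multiplicity one and is separated by no split of the system. -/
lemma Compatible.cons {X : Type} {M A B : Multiset X} {𝔖 : Multiset (Sym2 (Multiset X))}
    (h : Compatible M 𝔖) (h0 : 𝔖 ≠ 0) (hA0 : A ≠ 0) (hAB : A + B = M)
    (hA : ∀ x ∈ A, M.count x = 1) (hsplit : ∀ S ∈ 𝔖, ∃ C ∈ S, A ≤ C) (hnot : s(A, B) ∉ 𝔖) :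
    Compatible M (s(A, B) ::ₘ 𝔖) := by
  obtain ⟨⟨n, G, hconn, hacyc, ℓ, rfl, m2⟩, rfl⟩ := h
  simp only [MTree.splits_eq] at h0 hsplit hnot ⊢
  have htree : G.IsTree := ⟨hconn, hacyc⟩
  have hmem : ∀ u v, G.Adj u v →
      s(G.sidePart ℓ u v, G.sidePart ℓ v u) ∈ G.edgeFinset.val.map (G.edgeSplit ℓ) :=
    fun u v huv => Multiset.mem_map.2 ⟨s(u, v), by simpa using huv, rfl⟩
  obtain ⟨v, hv⟩ := htree.exists_le_label hA0 hA (hAB ▸ Multiset.le_add_right A B)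
    fun u v huv => by
      obtain ⟨C, hC, hAC⟩ := hsplit _ (hmem u v huv)
      rcases Sym2.mem_iff.1 hC with rfl | rfl
      exacts [.inl hAC, .inr hAC]
  have hdeg : ℓ v = A → 2 ≤ G.degree v := by
    intro hvA
    by_contra! hlt
    obtain ⟨w, hw⟩ : ∃ w, G.Adj v w := by
      obtain ⟨e, he⟩ : ∃ e, e ∈ G.edgeSet := by
        simpa [Set.eq_empty_iff_forall_notMem, ← edgeSet_eq_empty] using h0
      induction e with | _ x y
      have : Nontrivial (Fin n) := ⟨x, y, G.ne_of_adj he⟩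
      exact (G.degree_pos_iff_exists_adj v).1 (hconn.preconnected.degree_pos_of_nontrivial v)
    have huniq : ∀ w', G.Adj v w' → w' = w := fun w' hw' =>
      Finset.card_le_one.1 (by rw [card_neighborFinset_eq_degree]; lia)
        w' ((G.mem_neighborFinset v w').2 hw') w ((G.mem_neighborFinset v w).2 hw)
    have h₁ : G.sidePart ℓ v w = A :=
      (hconn.sidePart_eq_label hw.ne huniq).trans hvA
    have h₂ := htree.sidePart_add_sidePart (ℓ := ℓ) hw
    rw [h₁, ← hAB] at h₂
    have h₃ := hmem v w hw
    rw [h₁, add_left_cancel h₂] at h₃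
    exact hnot h₃
  refine ⟨⟨n + 1, G.addLeaf v, (htree.addLeaf v).connected, (htree.addLeaf v).isAcyclic,
    addLeafLabel ℓ v A, sum_addLeafLabel hv, fun w => ?_⟩, ?_⟩
  swap
  · rw [MTree.splits_eq]
    exact htree.edgeSplits_addLeaf hv hAB
  induction w using Fin.lastCases with
  | last => simpa using fun _ => hA0
  | cast w =>
    rw [addLeaf_degree_castSucc, addLeafLabel_castSucc]
    by_cases hw : w = v
    · subst hw
      simp only [if_true]
      intro h h0
      have := hdeg (le_antisymm (tsub_eq_zero_iff_le.1 h0) hv)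
      lia
    · simpa [hw] using m2 w

/-- Lemma. Let `𝔖` be a split system on `M` of size `n ≥ 3` such
that every proper submultiset of `𝔖` is compatible. If there is a split
`S = A|Ā ∈ 𝔖` such that every element of `A` has multiplicity 1 in `M`, then `𝔖`
is compatible. -/
theorem stmt5 {X : Type} [DecidableEq X] (M : Multiset X)
    (𝔖 : Multiset (Sym2 (Multiset X))) (hsys : IsSplitSystem M 𝔖)
    (hcard : 3 ≤ Multiset.card 𝔖)
    (hproper : ∀ 𝔖' : Multiset (Sym2 (Multiset X)), 𝔖' < 𝔖 → Compatible M 𝔖')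
    (hA : ∃ S ∈ 𝔖, ∃ A B : Multiset X, S = s(A, B) ∧ ∀ x ∈ A, M.count x = 1) :
    Compatible M 𝔖 := by
  have hpair : ∀ S T, {S, T} ≤ 𝔖 → Compatible M {S, T} := fun S T h =>
    hproper _ (lt_of_le_of_ne h fun h => by simp [← h] at hcard)
  have hsplit : ∀ A B, s(A, B) ∈ 𝔖 → A ≠ 0 ∧ A + B = M := fun A B h => by
    obtain ⟨C, D, hCD, hC, hD, rfl⟩ := hsys _ h
    rcases Sym2.eq_iff.1 hCD with ⟨rfl, rfl⟩ | ⟨rfl, rfl⟩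
    exacts [⟨hC, rfl⟩, ⟨hD, add_comm _ _⟩]
  obtain ⟨A, ⟨⟨B, hS⟩, hA'⟩, hmin⟩ := exists_minimal_of_wellFoundedLT
    (fun A : Multiset X => (∃ B, s(A, B) ∈ 𝔖) ∧ ∀ x ∈ A, M.count x = 1) (by
      obtain ⟨S, hS, A, B, rfl, hA⟩ := hA
      exact ⟨A, ⟨B, hS⟩, hA⟩)
  obtain ⟨hA0, hAB⟩ := hsplit A B hS
  obtain ⟨𝔗, rfl⟩ := Multiset.exists_cons_of_mem hS
  have hself : ∀ C, C ≤ A → C ≤ B → C = 0 := fun C hCA hCB => by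
    refine Multiset.eq_zero_of_forall_notMem fun x hx => ?_
    have h₁ := Multiset.mem_of_le hCA hx
    have h₂ := Multiset.count_pos.2 (Multiset.mem_of_le hCB hx)
    have h₃ := Multiset.count_pos.2 h₁
    have h₄ := hA' x h₁
    rw [← hAB, Multiset.count_add] at h₄
    lia
  have hle : ∀ T ∈ 𝔗, ({s(A, B), T} : Multiset _) ≤ s(A, B) ::ₘ 𝔗 := fun T hT =>
    Multiset.cons_le_cons _ (Multiset.singleton_le.2 hT)
  refine (hproper 𝔗 (Multiset.lt_cons_self _ _)).cons ?_ hA0 hAB (by convert hA')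
    (fun T hT => ?_) fun hT => ?_
  · rintro rfl
    simp at hcard
  · obtain ⟨P, Q, R, hP, hQ, hR, -, hS', rfl⟩ := (hpair _ _ (hle T hT)).exists_of_pair
    rcases Sym2.eq_iff.1 hS' with ⟨rfl, rfl⟩ | ⟨rfl, rfl⟩
    · exact ⟨A + Q, by simp, Multiset.le_add_right _ _⟩
    · have hRA : R ≤ Q + R := Multiset.le_add_left _ _
      have := hmin ⟨⟨_, Multiset.mem_cons_of_mem hT⟩,
        fun x hx => hA' x (Multiset.mem_of_le hRA hx)⟩ hRA
      simp [hQ] at this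
  · obtain ⟨P, Q, R, hP, hQ, hR, -, h₁, h₂⟩ := (hpair _ _ (hle _ hT)).exists_of_pair
    rcases Sym2.eq_iff.1 h₁ with ⟨rfl, rfl⟩ | ⟨rfl, rfl⟩ <;>
      rcases Sym2.eq_iff.1 h₂ with ⟨h₃, h₄⟩ | ⟨h₃, h₄⟩
    · exact hR (hself R h₃.ge (Multiset.le_add_left _ _))
    · simp [hQ] at h₃
    · simp [hQ] at h₃
    · exact hR (hself R (Multiset.le_add_left _ _) h₄.ge)
end

section
/- Suppose that 𝔖 is a thin split system on a finite multiset 𝓜. Then 𝔖 is compatible if and only if every submultiset of 𝔖 of size at most Δ(𝓜)+2 is compatible. -/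
open scoped Classical

/-- The vertices reachable from `u` without using the edge `{u, v}`. -/
def Side {V : Type} (G : SimpleGraph V) (u v w : V) : Prop :=
  Relation.ReflTransGen (fun x y => G.Adj x y ∧ s(x, y) ≠ s(u, v)) u w

theorem side_iff_reachable {V : Type} (G : SimpleGraph V) (u v w : V) :
    Side G u v w ↔ (G.deleteEdges {s(u, v)}).Reachable u w := by
  rw [SimpleGraph.reachable_iff_reflTransGen, Side]
  have : (fun x y => G.Adj x y ∧ s(x, y) ≠ s(u, v)) = (G.deleteEdges {s(u, v)}).Adj := by
    ext x y
    simp [SimpleGraph.deleteEdges_adj]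
  rw [this]

namespace Side

variable {V : Type} {G : SimpleGraph V}

theorem self (u v : V) : Side G u v u := Relation.ReflTransGen.refl

theorem step {u v x y : V} (h : Side G u v x) (hxy : G.Adj x y) (hne : s(x, y) ≠ s(u, v)) :
    Side G u v y := h.tail ⟨hxy, hne⟩

theorem trans_of_not {u v a b x : V} (hu : Side G a b u)
    (h : ¬ Side G u v a ∨ ¬ Side G u v b) (hx : Side G u v x) : Side G a b x := by
  induction hx with
  | refl => exact hu
  | @tail y z hy hyz ih =>
    refine ih.step hyz.1 fun he => ?_
    have hz : Side G u v z := hy.tail hyz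
    change Side G u v y at hy
    rw [Sym2.eq_iff] at he
    rcases he with ⟨rfl, rfl⟩ | ⟨rfl, rfl⟩ <;> tauto

theorem cover {u v : V} (conn : ∀ x y, Relation.ReflTransGen G.Adj x y) (w : V) :
    Side G u v w ∨ Side G v u w := by
  induction conn u w with
  | refl => exact Or.inl (self u v)
  | @tail y z _ hyz ih =>
    by_cases he : s(y, z) = s(u, v)
    · rw [Sym2.eq_iff] at he
      rcases he with ⟨rfl, rfl⟩ | ⟨rfl, rfl⟩
      · exact Or.inr (self _ _)
      · exact Or.inl (self _ _)
    · refine ih.imp (fun h => h.step hyz he) (fun h => h.step hyz ?_)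
      rwa [Sym2.eq_swap (a := v)]

theorem symm {u v w : V} (h : Side G u v w) :
    Relation.ReflTransGen (fun x y => G.Adj x y ∧ s(x, y) ≠ s(u, v)) w u := by
  induction h with
  | refl => exact .refl
  | @tail y z _ hyz ih => exact ih.head ⟨hyz.1.symm, by rw [Sym2.eq_swap]; exact hyz.2⟩

theorem not_both {u v w : V} (hb : ¬ Side G u v v) (h : Side G u v w) : ¬ Side G v u w := by
  intro h'
  have h2 := h'.symm
  rw [Sym2.eq_swap] at h2
  exact hb (Relation.ReflTransGen.trans h h2)

end Side

variable {X : Type}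

/-- A tree with vertex set `V`, labelled by submultisets of `M`, whose edges are indexed by `J`
and represent the splits `P i true | P i false` for `i ∈ J`. -/
structure SplitTree {n : ℕ} (M : Multiset X) (P : Fin n → Bool → Multiset X)
    (J : Finset (Fin n)) (V : Type) [Fintype V] where
  G : SimpleGraph V
  label : V → Multiset X
  ends : Fin n → Bool → V
  conn : ∀ x y, Relation.ReflTransGen G.Adj x y
  bridge : ∀ x y, G.Adj x y → ¬ Side G x y y
  adj : ∀ i ∈ J, ∀ b, G.Adj (ends i b) (ends i !b)
  surj : ∀ x y, G.Adj x y → ∃ i ∈ J, ∃ b, ends i b = x ∧ ends i (!b) = y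
  inj : ∀ i ∈ J, ∀ j ∈ J, ∀ b c, ends i b = ends j c → ends i (!b) = ends j (!c) → i = j
  part : ∀ i ∈ J, ∀ b, ∑ w with Side G (ends i b) (ends i !b) w, label w = P i b
  total : ∑ w, label w = M
  branch : ∀ v u, G.Adj v u → label v = 0 →
    ∃ z₁ z₂, G.Adj v z₁ ∧ G.Adj v z₂ ∧ z₁ ≠ u ∧ z₂ ≠ u ∧ z₁ ≠ z₂

namespace SplitTree

variable {n : ℕ} {M : Multiset X} {P : Fin n → Bool → Multiset X}
  {J : Finset (Fin n)} {V : Type} [Fintype V] (T : SplitTree M P J V)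

theorem not_side_iff {x y : V} (h : T.G.Adj x y) (w : V) :
    ¬ Side T.G x y w ↔ Side T.G y x w :=
  ⟨(Side.cover T.conn w).resolve_left, fun h1 h2 => Side.not_both (T.bridge x y h) h2 h1⟩

theorem side_disjoint {v z₁ z₂ w : V} (h₁ : T.G.Adj v z₁) (h₂ : T.G.Adj v z₂) (hne : z₁ ≠ z₂)
    (hw : Side T.G z₁ v w) : ¬ Side T.G z₂ v w := by
  rw [T.not_side_iff h₂.symm]
  refine Side.trans_of_not ?_ (Or.inl (T.bridge _ _ h₁.symm)) hw
  exact (Side.self v z₂).step h₁ (by simp [hne, h₁.ne'])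

theorem exists_label_ne_zero (hne : ∀ i b, P i b ≠ 0) {x y : V} (h : T.G.Adj x y) :
    ∃ w, Side T.G x y w ∧ T.label w ≠ 0 := by
  obtain ⟨i, hi, b, rfl, rfl⟩ := T.surj x y h
  by_contra! hc
  refine hne i b ?_
  rw [← T.part i hi b]
  exact Finset.sum_eq_zero fun w hw => hc w (Finset.mem_filter.1 hw).2

theorem exists_label_ne_zero_between (hne : ∀ i b, P i b ≠ 0) {u v a b : V}
    (huv : T.G.Adj u v) (hab : T.G.Adj a b) (hneq : s(u, v) ≠ s(a, b))
    (hsub : ∀ w, Side T.G u v w → Side T.G a b w) :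
    ∃ w, Side T.G a b w ∧ ¬ Side T.G u v w ∧ T.label w ≠ 0 := by
  have hv : Side T.G a b v := (hsub u (Side.self u v)).step huv hneq
  have hvb : v ≠ b := fun h => T.bridge a b hab (h ▸ hv)
  by_cases hl : T.label v = 0
  · obtain ⟨z₁, z₂, h₁, h₂, hz₁, hz₂, hz⟩ := T.branch v u huv.symm hl
    obtain ⟨z, hvz, hzu, hzb⟩ : ∃ z, T.G.Adj v z ∧ z ≠ u ∧ ¬ Side T.G z v b := by
      by_cases h : Side T.G z₁ v b
      · exact ⟨z₂, h₂, hz₂, T.side_disjoint h₁ h₂ hz h⟩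
      · exact ⟨z₁, h₁, hz₁, h⟩
    obtain ⟨w, hw, hlw⟩ := T.exists_label_ne_zero hne hvz.symm
    refine ⟨w, ?_, T.side_disjoint hvz huv.symm hzu hw, hlw⟩
    refine Side.trans_of_not (hv.step hvz ?_) (Or.inr hzb) hw
    have : z ≠ b := fun h => hzb (h ▸ Side.self z v)
    simp [hvb, this]
  · exact ⟨v, hv, T.bridge u v huv, hl⟩

theorem ends_ne {i j : Fin n} (hi : i ∈ J) (hj : j ∈ J) (hij : i ≠ j) (b c : Bool) :
    s(T.ends i b, T.ends i !b) ≠ s(T.ends j c, T.ends j !c) := by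
  rw [Ne, Sym2.eq_iff]
  rintro (⟨h1, h2⟩ | ⟨h1, h2⟩)
  · exact hij (T.inj i hi j hj b c h1 h2)
  · exact hij (T.inj i hi j hj b (!c) h1 (by simpa using h2))

theorem not_side_ends_iff {i : Fin n} (hi : i ∈ J) (b : Bool) (w : V) :
    ¬ Side T.G (T.ends i b) (T.ends i !b) w ↔ Side T.G (T.ends i !b) (T.ends i b) w :=
  T.not_side_iff (T.adj i hi b) w

theorem gammaArc_of_side_subset (hne : ∀ i b, P i b ≠ 0) {i j : Fin n} (hi : i ∈ J) (hj : j ∈ J)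
    (hij : i ≠ j) {b c : Bool}
    (hsub : ∀ w, Side T.G (T.ends i b) (T.ends i !b) w → Side T.G (T.ends j c) (T.ends j !c) w) :
    GammaArc P (i, b) (j, c) := by
  refine ⟨hij, ?_⟩
  obtain ⟨w, hw, hnw, hl⟩ := T.exists_label_ne_zero_between hne (T.adj i hi b) (T.adj j hj c)
    (T.ends_ne hi hj hij b c) hsub
  dsimp only
  rw [← T.part i hi b, ← T.part j hj c]
  refine Finset.sum_lt_sum_of_subset (i := w) ?_ ?_ ?_ ?_ ?_
  · intro x hx
    simp only [Finset.mem_filter, Finset.mem_univ, true_and] at hx ⊢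
    exact hsub x hx
  · simpa using hw
  · simpa using hnw
  · exact pos_iff_ne_zero.2 hl
  · intros; exact zero_le

theorem exists_side_subset {i j : Fin n} (hi : i ∈ J) (hj : j ∈ J) (hij : i ≠ j) :
    ∃ b c : Bool, ∀ w, Side T.G (T.ends i b) (T.ends i !b) w →
      Side T.G (T.ends j c) (T.ends j !c) w := by
  obtain ⟨c, hc⟩ : ∃ c, Side T.G (T.ends j c) (T.ends j !c) (T.ends i true) := by
    by_cases h : Side T.G (T.ends j true) (T.ends j !true) (T.ends i true)
    · exact ⟨true, h⟩
    · exact ⟨false, (T.not_side_ends_iff hj true _).1 h⟩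
  by_cases h : Side T.G (T.ends i true) (T.ends i !true) (T.ends j c)
  · refine ⟨false, c, fun w hw => Side.trans_of_not ?_ (Or.inl ?_) hw⟩
    · exact hc.step (T.adj i hi true) (T.ends_ne hi hj hij true c)
    · intro h'
      exact (T.not_side_ends_iff hi false _).2 h h'
  · exact ⟨true, c, fun w hw => Side.trans_of_not hc (Or.inl h) hw⟩

end SplitTree

/-- The arcs between the vertices belonging to two distinct splits of a thin system are
unique. -/
theorem IsThinSubgraph.unique {n : ℕ} {P : Fin n → Bool → Multiset X}
    {G : Fin n × Bool → Fin n × Bool → Prop} (h : IsThinSubgraph P G) {i j : Fin n} (hij : i ≠ j)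
    {b b' c c' : Bool} (h₁ : G (i, b) (j, c)) (h₂ : G (i, b') (j, c')) : b = b' ∧ c = c' := by
  obtain ⟨x, y, hxy⟩ := h.2 i j hij
  obtain ⟨rfl, rfl⟩ := (hxy b c).1.1 h₁
  obtain ⟨rfl, rfl⟩ := (hxy b' c').1.1 h₂
  exact ⟨rfl, rfl⟩

/-- The parts in `F` belong to different splits, and each is properly contained in the
complements of the others. -/
def IsStar {n : ℕ} (P : Fin n → Bool → Multiset X) (F : Finset (Fin n × Bool)) : Prop :=
  ∀ p ∈ F, ∀ q ∈ F, p ≠ q → GammaArc P p (q.1, !q.2)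

theorem SplitTree.sum_star_le {n : ℕ} {M : Multiset X} {P : Fin n → Bool → Multiset X}
    {J : Finset (Fin n)} {V : Type} [Fintype V] (T : SplitTree M P J V)
    (hne : ∀ i b, P i b ≠ 0) (hthin : IsThinSubgraph P (GammaArc P))
    {F : Finset (Fin n × Bool)} (hFJ : ∀ p ∈ F, p.1 ∈ J) (hF : IsStar P F) :
    ∑ p ∈ F, P p.1 p.2 ≤ M := by
  have hdisj : ∀ p ∈ F, ∀ q ∈ F, p ≠ q → ∀ w, Side T.G (T.ends p.1 p.2) (T.ends p.1 !p.2) w →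
      ¬ Side T.G (T.ends q.1 q.2) (T.ends q.1 !q.2) w := by
    intro p hp q hq hpq w hw
    have harc := hF p hp q hq hpq
    have hij : p.1 ≠ q.1 := harc.1
    obtain ⟨b, c, hsub⟩ := T.exists_side_subset (hFJ p hp) (hFJ q hq) hij
    obtain ⟨rfl, rfl⟩ := hthin.unique hij harc
      (T.gammaArc_of_side_subset hne (hFJ p hp) (hFJ q hq) hij hsub)
    rw [T.not_side_ends_iff (hFJ q hq)]
    simpa using hsub w hw
  calc ∑ p ∈ F, P p.1 p.2
      = ∑ p ∈ F, ∑ w, if Side T.G (T.ends p.1 p.2) (T.ends p.1 !p.2) w then T.label w else 0 := by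
        refine Finset.sum_congr rfl fun p hp => ?_
        rw [← T.part p.1 (hFJ p hp), Finset.sum_filter]
    _ = ∑ w, ∑ p ∈ F, if Side T.G (T.ends p.1 p.2) (T.ends p.1 !p.2) w then T.label w else 0 :=
        Finset.sum_comm
    _ ≤ ∑ w, T.label w := by
        refine Finset.sum_le_sum fun w _ => ?_
        by_cases h : ∃ p ∈ F, Side T.G (T.ends p.1 p.2) (T.ends p.1 !p.2) w
        · obtain ⟨p, hp, hw⟩ := h
          rw [Finset.sum_eq_single_of_mem p hp]
          · rw [if_pos hw]
          · intro q hq hqp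
            rw [if_neg (hdisj p hp q hq hqp.symm w hw)]
        · push Not at h
          rw [Finset.sum_eq_zero fun p hp => if_neg (h p hp)]
          exact zero_le
    _ = M := T.total

theorem exists_matching_of_map_eq {α β γ : Type} [Nonempty α] (f : α → γ) (g : β → γ)
    (t : Finset β) : ∀ s : Finset α, s.val.map f = t.val.map g →
      ∃ φ : β → α, (∀ b ∈ t, φ b ∈ s ∧ f (φ b) = g b) ∧ Set.InjOn φ t ∧
        ∀ a ∈ s, ∃ b ∈ t, φ b = a := by
  induction t using Finset.induction_on with
  | empty =>
    intro s h
    have hs : s = ∅ := by simpa using h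
    subst hs
    exact ⟨fun _ => Classical.arbitrary α, by simp, by simp, by simp⟩
  | @insert b t hb ih =>
    intro s h
    rw [Finset.insert_val_of_notMem hb, Multiset.map_cons] at h
    obtain ⟨a, ha, hab, h'⟩ := (Multiset.map_eq_cons f s.val _ _).2 h
    rw [← Finset.erase_val] at h'
    obtain ⟨φ, h1, h2, h3⟩ := ih (s.erase a) h'
    have hupd : ∀ c ∈ t, Function.update φ b a c = φ c := fun c hc =>
      Function.update_of_ne (by rintro rfl; exact hb hc) _ _
    refine ⟨Function.update φ b a, ?_, ?_, ?_⟩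
    · intro c hc
      rcases Finset.mem_insert.1 hc with rfl | hc
      · simpa [hab] using ha
      · rw [hupd c hc]
        exact ⟨Finset.mem_of_mem_erase (h1 c hc).1, (h1 c hc).2⟩
    · rw [Finset.coe_insert, Set.injOn_insert (by simpa using hb)]
      refine ⟨fun c hc d hd hcd => h2 hc hd ?_, ?_⟩
      · rwa [hupd c hc, hupd d hd] at hcd
      · rintro ⟨c, hc, hca⟩
        rw [hupd c hc, Function.update_self] at hca
        exact Finset.ne_of_mem_erase (h1 c hc).1 hca
    · intro c hc
      by_cases hca : c = a
      · exact ⟨b, Finset.mem_insert_self _ _, by simp [hca]⟩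
      · obtain ⟨d, hd, rfl⟩ := h3 c (Finset.mem_erase.2 ⟨hca, hc⟩)
        exact ⟨d, Finset.mem_insert_of_mem hd, hupd d hd⟩

theorem exists_subset_of_le_map {β γ : Type} (g : β → γ) (m : Multiset γ) :
    ∀ t : Finset β, m ≤ t.val.map g → ∃ s ⊆ t, s.val.map g = m := by
  induction m using Multiset.induction_on with
  | empty => exact fun t _ => ⟨∅, by simp, by simp⟩
  | cons a m ih =>
    intro t h
    obtain ⟨b, hb, rfl⟩ := Multiset.mem_map.1 (Multiset.mem_of_le h (Multiset.mem_cons_self a m))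
    have hbt : b ∈ t := hb
    have ht : t.val = b ::ₘ (t.erase b).val := by
      rw [← Finset.insert_val_of_notMem (Finset.notMem_erase b t), Finset.insert_erase hbt]
    rw [ht, Multiset.map_cons, Multiset.cons_le_cons_iff] at h
    obtain ⟨s, hs, rfl⟩ := ih _ h
    refine ⟨insert b s, Finset.insert_subset hbt (hs.trans (Finset.erase_subset _ _)), ?_⟩
    rw [Finset.insert_val_of_notMem fun hbs => Finset.notMem_erase b t (hs hbs), Multiset.map_cons]

section MTree

variable {n : ℕ} {M : Multiset X} {P : Fin n → Bool → Multiset X} {J : Finset (Fin n)}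

theorem MTree.part_eq (T : MTree X M) (u v : Fin T.n) :
    T.part u v = ∑ w with Side T.G u v w, T.label w := by
  unfold MTree.part
  congr 1
  ext w
  simp [side_iff_reachable]

theorem MTree.exists_splitTree (T : MTree X M)
    (hT : T.splits = J.val.map fun i => s(P i true, P i false)) :
    Nonempty (SplitTree M P J (Fin T.n)) := by
  have : Nonempty (Fin T.n) := T.connected.nonempty
  have : Nonempty (Sym2 (Fin T.n)) := this.map fun v => s(v, v)
  obtain ⟨φ, h1, h2, h3⟩ := exists_matching_of_map_eq _ _ J _ hT
  have key : ∀ i, ∃ e : Bool → Fin T.n, i ∈ J →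
      s(e true, e false) = φ i ∧ ∀ b, T.part (e b) (e !b) = P i b := by
    intro i
    by_cases hi : i ∈ J
    · obtain ⟨-, h⟩ := h1 i hi
      generalize φ i = z at h ⊢
      induction z using Sym2.ind with
      | _ u v =>
        simp only [Sym2.lift_mk, Sym2.eq_iff] at h
        rcases h with h | h
        · exact ⟨fun b => cond b u v, fun _ => ⟨rfl, by simpa using ⟨h.2, h.1⟩⟩⟩
        · exact ⟨fun b => cond b v u, fun _ => ⟨Sym2.eq_swap, by simpa using ⟨h.1, h.2⟩⟩⟩
    · exact ⟨fun _ => Classical.arbitrary _, fun h => absurd h hi⟩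
  choose e he using key
  have hs : ∀ i ∈ J, ∀ b, s(e i b, e i !b) = φ i := by
    intro i hi b
    rw [← (he i hi).1]
    cases b
    · exact Sym2.eq_swap
    · rfl
  refine ⟨⟨T.G, T.label, e, ?_, ?_, ?_, ?_, ?_, ?_, T.m1, ?_⟩⟩
  · intro x y
    exact (SimpleGraph.reachable_iff_reflTransGen x y).1 (T.connected.preconnected x y)
  · intro x y hxy
    rw [side_iff_reachable]
    exact SimpleGraph.isAcyclic_iff_forall_adj_isBridge.1 T.acyclic hxy
  · intro i hi b
    have := (h1 i hi).1
    rw [← hs i hi b] at this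
    simpa using this
  · intro x y hxy
    obtain ⟨i, hi, h⟩ := h3 s(x, y) (by simpa using hxy)
    rw [← (he i hi).1, Sym2.eq_iff] at h
    rcases h with ⟨h, h'⟩ | ⟨h, h'⟩
    · exact ⟨i, hi, true, h, h'⟩
    · exact ⟨i, hi, false, h', h⟩
  · intro i hi j hj b c h h'
    refine h2 hi hj ?_
    rw [← hs i hi b, ← hs j hj c, h, h']
  · intro i hi b
    rw [← MTree.part_eq]
    exact (he i hi).2 b
  · intro v u hvu hl
    have hu : u ∈ T.G.neighborFinset v := by simpa using hvu
    have hpos : 0 < T.G.degree v := Finset.card_pos.2 ⟨u, hu⟩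
    have hm := mt (T.m2 v) (not_not.2 hl)
    have hcard : 1 < ((T.G.neighborFinset v).erase u).card := by
      rw [Finset.card_erase_of_mem hu, SimpleGraph.card_neighborFinset_eq_degree]
      omega
    obtain ⟨z₁, hz₁, z₂, hz₂, hz⟩ := Finset.one_lt_card.1 hcard
    simp only [Finset.mem_erase, SimpleGraph.mem_neighborFinset] at hz₁ hz₂
    exact ⟨z₁, z₂, hz₁.2, hz₂.2, hz₁.1, hz₂.1, hz⟩

theorem side_comap_iff {V W : Type} (G : SimpleGraph V) (f : W ≃ V) (u v w : W) :
    Side (G.comap f) u v w ↔ Side G (f u) (f v) (f w) := by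
  have hs : ∀ x y : W, s(f x, f y) = s(f u, f v) ↔ s(x, y) = s(u, v) := by
    intro x y
    simp
  constructor
  · exact Relation.ReflTransGen.lift (p := fun x y => G.Adj x y ∧ s(x, y) ≠ s(f u, f v)) f
      (fun x y h => ⟨h.1, fun h' => h.2 ((hs x y).1 h')⟩) _ _
  · intro h
    have := Relation.ReflTransGen.lift
      (p := fun x y => (G.comap f).Adj x y ∧ s(x, y) ≠ s(u, v)) f.symm
      (fun x y h => ⟨by simpa using h.1, fun h' => h.2 (by
        simpa using (hs (f.symm x) (f.symm y)).2 h')⟩) _ _ h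
    simpa [Side, Function.onFun] using this

theorem SplitTree.compatible {V : Type} [Fintype V] [Nonempty V] (T : SplitTree M P J V) :
    Compatible M (J.val.map fun i => s(P i true, P i false)) := by
  let φ : Fin (Fintype.card V) ≃ V := (Fintype.equivFin V).symm
  have hpart : ∀ u v, (∑ w with Side (T.G.comap φ) u v w, T.label (φ w)) =
      ∑ w with Side T.G (φ u) (φ v) w, T.label w := by
    intro u v
    rw [Finset.sum_filter, Finset.sum_filter, ← Equiv.sum_comp φ]
    simp_rw [side_comap_iff]
  let T' : MTree X M :=
    { n := Fintype.card V
      G := T.G.comap φ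
      connected := by
        have : Nonempty (Fin (Fintype.card V)) := ⟨φ.symm (Classical.arbitrary V)⟩
        refine ⟨fun x y => ?_⟩
        rw [SimpleGraph.reachable_iff_reflTransGen]
        have := Relation.ReflTransGen.lift (p := (T.G.comap φ).Adj) φ.symm
          (fun x y h => by simpa using h) _ _ (T.conn (φ x) (φ y))
        simpa [Function.onFun] using this
      acyclic := by
        rw [SimpleGraph.isAcyclic_iff_forall_adj_isBridge]
        intro x y hxy
        rw [SimpleGraph.isBridge_iff, ← side_iff_reachable, side_comap_iff]
        exact T.bridge _ _ hxy
      label := fun w => T.label (φ w)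
      m1 := (Equiv.sum_comp φ T.label).trans T.total
      m2 := by
        intro v hdeg hl
        obtain ⟨S, hS, hmem⟩ : ∃ S : Finset (Fin (Fintype.card V)),
            (S.card = 1 ∨ S.card = 2) ∧ ∀ x, x ∈ S ↔ (T.G.comap φ).Adj v x :=
          ⟨_, hdeg, fun x => SimpleGraph.mem_neighborFinset _ _ _⟩
        obtain ⟨u, hu⟩ : S.Nonempty := by
          rw [← Finset.card_pos]; omega
        rw [hmem] at hu
        obtain ⟨z₁, z₂, h₁, h₂, hz₁, hz₂, hz⟩ := T.branch _ _ hu hl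
        have hsub : ({u, φ.symm z₁, φ.symm z₂} : Finset _) ⊆ S := by
          intro x hx
          simp only [Finset.mem_insert, Finset.mem_singleton] at hx
          rw [hmem]
          rcases hx with rfl | rfl | rfl
          · exact hu
          · simpa using h₁
          · simpa using h₂
        have hcard := Finset.card_le_card hsub
        rw [Finset.card_eq_three.2 ⟨u, φ.symm z₁, φ.symm z₂, ?_, ?_, ?_, rfl⟩] at hcard
        · omega
        · rintro rfl; simp at hz₁
        · rintro rfl; simp at hz₂
        · simpa using hz }
  have hparts : ∀ u v, T'.part u v = ∑ w with Side T.G (φ u) (φ v) w, T.label w := by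
    intro u v
    rw [MTree.part_eq]
    exact hpart u v
  refine ⟨T', ?_⟩
  unfold MTree.splits
  symm
  refine Multiset.map_eq_map_of_bij_of_nodup _ _ J.nodup (Finset.nodup _)
    (fun i _ => s(φ.symm (T.ends i true), φ.symm (T.ends i false))) ?_ ?_ ?_ ?_
  · intro i hi
    rw [Finset.mem_val, SimpleGraph.mem_edgeFinset, SimpleGraph.mem_edgeSet]
    simpa [T'] using T.adj i hi true
  · intro i hi j hj h
    by_contra hij
    refine T.ends_ne hi hj hij true true ?_
    simpa [Sym2.eq_iff] using h
  · intro e he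
    rw [Finset.mem_val, SimpleGraph.mem_edgeFinset] at he
    induction e using Sym2.ind with
    | _ x y =>
      obtain ⟨i, hi, b, hx, hy⟩ := T.surj _ _ he
      refine ⟨i, hi, ?_⟩
      cases b <;> simp at hx hy <;> simp [hx, hy, Sym2.eq_swap]
  · intro i hi
    simp only [Sym2.lift_mk, hparts, Equiv.apply_symm_apply]
    have h1 := T.part i hi true
    have h2 := T.part i hi false
    simp only [Bool.not_true, Bool.not_false] at h1 h2
    rw [h1, h2]

end MTree

/-- The graph `G` with a new vertex `none` joined to `w`. -/
def leafGraph {V : Type} (G : SimpleGraph V) (w : V) : SimpleGraph (Option V) where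
  Adj
    | some x, some y => G.Adj x y
    | some x, none => x = w
    | none, some y => y = w
    | none, none => False
  symm := ⟨by
    rintro (_ | x) (_ | y) h
    · exact h
    · exact h
    · exact h
    · exact G.adj_symm h⟩
  loopless := ⟨by
    rintro (_ | x) h
    · exact h
    · exact G.loopless.irrefl x h⟩

section LeafGraph

variable {V : Type} {G : SimpleGraph V} {w : V}

@[simp] theorem leafGraph_adj_some_some {x y : V} :
    (leafGraph G w).Adj (some x) (some y) ↔ G.Adj x y := Iff.rfl

@[simp] theorem leafGraph_adj_some_none {x : V} :
    (leafGraph G w).Adj (some x) none ↔ x = w := Iff.rfl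

@[simp] theorem leafGraph_adj_none_some {y : V} :
    (leafGraph G w).Adj none (some y) ↔ y = w := Iff.rfl

@[simp] theorem leafGraph_adj_none_none : ¬ (leafGraph G w).Adj none none := id

theorem side_leafGraph_some_some {a b : V} (x : Option V) :
    Side (leafGraph G w) (some a) (some b) x ↔ Side G a b (x.getD w) := by
  have hsome : ∀ c, Side G a b c → Side (leafGraph G w) (some a) (some b) (some c) := by
    intro c hc
    induction hc with
    | refl => exact Side.self _ _
    | tail _ hyz ih =>
      refine ih.step (leafGraph_adj_some_some.2 hyz.1) ?_
      simpa [Sym2.eq_iff] using hyz.2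
  constructor
  · intro h
    induction h with
    | refl => exact Side.self _ _
    | @tail y z _ hyz ih =>
      obtain ⟨hadj, hne⟩ := hyz
      rcases y with _ | y <;> rcases z with _ | z
      · exact ih
      · obtain rfl : z = w := hadj
        exact ih
      · obtain rfl : y = w := hadj
        exact ih
      · exact ih.step hadj (by simpa [Sym2.eq_iff] using hne)
  · rcases x with _ | x
    · intro h
      exact (hsome _ h).step (x := some w) (leafGraph_adj_some_none.2 rfl) (by simp)
    · exact hsome x

theorem side_leafGraph_none (x : Option V) :
    Side (leafGraph G w) none (some w) x ↔ x = none := by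
  constructor
  · intro h
    induction h with
    | refl => rfl
    | @tail y z _ hyz ih =>
      subst ih
      rcases z with _ | z
      · rfl
      · obtain rfl : z = w := hyz.1
        exact absurd rfl hyz.2
  · rintro rfl
    exact Side.self _ _

theorem side_leafGraph_some_none (conn : ∀ x y, Relation.ReflTransGen G.Adj x y)
    (x : Option V) : Side (leafGraph G w) (some w) none x ↔ x ≠ none := by
  constructor
  · intro h
    induction h with
    | refl => simp
    | @tail y z _ hyz ih =>
      rcases z with _ | z
      · obtain ⟨y, rfl⟩ := Option.ne_none_iff_exists'.1 ih
        obtain rfl : y = w := hyz.1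
        exact absurd rfl hyz.2
      · simp
  · intro h
    obtain ⟨x, rfl⟩ := Option.ne_none_iff_exists'.1 h
    exact Relation.ReflTransGen.lift
      (p := fun x y => (leafGraph G w).Adj x y ∧ s(x, y) ≠ s(some w, none)) some
      (fun a b hab => ⟨hab, by simp⟩) _ _ (conn w x)

theorem leafGraph_conn (conn : ∀ x y, Relation.ReflTransGen G.Adj x y) (x y : Option V) :
    Relation.ReflTransGen (leafGraph G w).Adj x y := by
  have hsome : ∀ a b : V, Relation.ReflTransGen (leafGraph G w).Adj (some a) (some b) :=
    fun a b => Relation.ReflTransGen.lift (p := (leafGraph G w).Adj) some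
      (fun _ _ h => h) _ _ (conn a b)
  have hnw : (leafGraph G w).Adj none (some w) := leafGraph_adj_none_some.2 rfl
  rcases x with _ | x <;> rcases y with _ | y
  · exact .refl
  · exact (hsome w y).head hnw
  · exact (hsome x w).tail hnw.symm
  · exact hsome x y

/-- Move the submultiset `A` of the label of `w` to the new leaf. -/
noncomputable def leafLabel (label : V → Multiset X) (w : V) (A : Multiset X) : Option V → Multiset X
  | none => A
  | some x => if x = w then label x - A else label x

theorem sum_leafLabel [Fintype V] {label : V → Multiset X} {A : Multiset X} (hA : A ≤ label w)
    (Q : V → Prop) :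
    ∑ x with Q (Option.getD x w), leafLabel label w A x = ∑ x with Q x, label x := by
  rw [Finset.sum_filter, Finset.sum_filter, Fintype.sum_option,
    ← Finset.add_sum_erase _ _ (Finset.mem_univ w), ← add_assoc,
    ← Finset.add_sum_erase _ _ (Finset.mem_univ w)]
  congr 1
  · simp only [Option.getD_none, Option.getD_some, leafLabel, if_true]
    split_ifs
    · exact add_tsub_cancel_of_le hA
    · simp
  · refine Finset.sum_congr rfl fun x hx => ?_
    simp [leafLabel, Finset.ne_of_mem_erase hx]

end LeafGraph

/-- Attach a new leaf labelled `P i b` to the vertex `w`. -/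
theorem SplitTree.exists_insert {n : ℕ} {M : Multiset X} {P : Fin n → Bool → Multiset X}
    {J : Finset (Fin n)} {V : Type} [Fintype V] (T : SplitTree M P J V)
    {i : Fin n} (hi : i ∉ J) {b : Bool} {w : V} (hA : P i b ≤ T.label w) (hne : P i b ≠ 0)
    (hM : P i b + P i (!b) = M)
    (hw : T.label w = P i b → ∃ z₁ z₂, T.G.Adj w z₁ ∧ T.G.Adj w z₂ ∧ z₁ ≠ z₂) :
    Nonempty (SplitTree M P (insert i J) (Option V)) := by
  have hji : ∀ j ∈ J, j ≠ i := fun j hj h => hi (h ▸ hj)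
  have htotal : ∑ x, leafLabel T.label w (P i b) x = M := by
    have := sum_leafLabel hA fun _ => True
    simpa [T.total] using this
  refine ⟨⟨leafGraph T.G w, leafLabel T.label w (P i b),
    fun j c => if j = i then (if c = b then none else some w) else some (T.ends j c),
    leafGraph_conn T.conn, ?_, ?_, ?_, ?_, ?_, htotal, ?_⟩⟩
  · rintro (_ | x) (_ | y) h
    · simp at h
    · obtain rfl : y = w := h
      simp [side_leafGraph_none]
    · obtain rfl : x = w := h
      simp [side_leafGraph_some_none T.conn]
    · rw [side_leafGraph_some_some]
      exact T.bridge x y h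
  · intro j hj c
    by_cases h : j = i
    · subst h
      cases b <;> cases c <;> simp
    · simpa [h] using T.adj j (Finset.mem_of_mem_insert_of_ne hj h) c
  · rintro (_ | x) (_ | y) h
    · simp at h
    · obtain rfl : y = w := h
      exact ⟨i, Finset.mem_insert_self _ _, b, by simp⟩
    · obtain rfl : x = w := h
      exact ⟨i, Finset.mem_insert_self _ _, !b, by simp⟩
    · obtain ⟨j, hj, c, rfl, rfl⟩ := T.surj x y h
      exact ⟨j, Finset.mem_insert_of_mem hj, c, by simp [hji j hj]⟩
  · intro j hj k hk c d h h'
    by_cases hj' : j = i <;> by_cases hk' : k = i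
    · rw [hj', hk']
    · exfalso
      simp only [hj', hk', if_true, if_false] at h h'
      cases b <;> cases c <;> simp at h h'
    · exfalso
      simp only [hj', hk', if_true, if_false] at h h'
      cases b <;> cases d <;> simp at h h'
    · simp only [hj', hk', if_false, Option.some.injEq] at h h'
      exact T.inj j (Finset.mem_of_mem_insert_of_ne hj hj') k
        (Finset.mem_of_mem_insert_of_ne hk hk') c d h h'
  · intro j hj c
    by_cases h : j = i
    · subst h
      have hnone : ∑ x with Side (leafGraph T.G w) none (some w) x,
          leafLabel T.label w (P j b) x = P j b := by
        simp_rw [side_leafGraph_none]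
        refine (Finset.sum_eq_single_of_mem none (by simp) fun x hx hx' => ?_).trans rfl
        exact absurd (Finset.mem_filter.1 hx).2 hx'
      by_cases hc : c = b
      · subst hc
        simpa using hnone
      · obtain rfl : c = !b := by cases b <;> cases c <;> simp_all
        have hsplit := Finset.sum_filter_add_sum_filter_not Finset.univ
          (fun x => Side (leafGraph T.G w) none (some w) x) (leafLabel T.label w (P j b))
        rw [hnone, htotal] at hsplit
        rw [← add_left_cancel (hsplit.trans hM.symm)]
        refine Finset.sum_congr ?_ fun _ _ => rfl
        ext x
        simp [side_leafGraph_none, side_leafGraph_some_none T.conn]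
    · have := sum_leafLabel hA (Side T.G (T.ends j c) (T.ends j !c))
      rw [T.part j (Finset.mem_of_mem_insert_of_ne hj h)] at this
      simp only [h, if_false, side_leafGraph_some_some]
      exact this
  · rintro (_ | x) y hxy hl
    · exact absurd hl hne
    · by_cases hx : x = w
      · subst hx
        have hl' : T.label x = P i b := by
          refine le_antisymm ?_ hA
          simpa [leafLabel, tsub_eq_zero_iff_le] using hl
        obtain ⟨z₁, z₂, h₁, h₂, hz⟩ := hw hl'
        rcases y with _ | y
        · exact ⟨some z₁, some z₂, h₁, h₂, by simp, by simp, by simpa using hz⟩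
        · by_cases hzy : z₁ = y
          · exact ⟨none, some z₂, rfl, h₂, by simp, by simpa [← hzy] using hz.symm, by simp⟩
          · exact ⟨none, some z₁, rfl, h₁, by simp, by simpa using hzy, by simp⟩
      · rcases y with _ | y
        · exact absurd hxy hx
        · obtain ⟨z₁, z₂, h₁, h₂, hz₁, hz₂, hz⟩ := T.branch x y hxy
            (by simpa [leafLabel, hx] using hl)
          exact ⟨some z₁, some z₂, h₁, h₂, by simpa using hz₁, by simpa using hz₂,
            by simpa using hz⟩

theorem SplitTree.le_label_add_sum {n : ℕ} {M : Multiset X} {P : Fin n → Bool → Multiset X}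
    {J : Finset (Fin n)} {V : Type} [Fintype V] (T : SplitTree M P J V) (w : V) :
    M ≤ T.label w + ∑ p : Fin n × Bool with p.1 ∈ J ∧ T.ends p.1 (!p.2) = w, P p.1 p.2 := by
  have hcover : ∀ x, x = w ∨ ∃ p : Fin n × Bool, (p.1 ∈ J ∧ T.ends p.1 (!p.2) = w) ∧
      Side T.G (T.ends p.1 p.2) (T.ends p.1 !p.2) x := by
    intro x
    induction T.conn w x with
    | refl => exact Or.inl rfl
    | @tail y z _ hyz ih =>
      by_cases hz : z = w
      · exact Or.inl hz
      right
      by_cases hy : y = w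
      · subst hy
        obtain ⟨j, hj, c, rfl, rfl⟩ := T.surj y z hyz
        exact ⟨(j, !c), ⟨hj, by simp⟩, Side.self _ _⟩
      · obtain ⟨p, ⟨hp, hpw⟩, hside⟩ := ih.resolve_left hy
        refine ⟨p, ⟨hp, hpw⟩, hside.step hyz ?_⟩
        rw [hpw, Ne, Sym2.eq_iff]
        tauto
  set K : Finset (Fin n × Bool) := {p | p.1 ∈ J ∧ T.ends p.1 (!p.2) = w} with hK
  calc M = ∑ x, T.label x := T.total.symm
    _ ≤ ∑ x, ((if x = w then T.label x else 0) +
          ∑ p ∈ K, if Side T.G (T.ends p.1 p.2) (T.ends p.1 !p.2) x then T.label x else 0) := by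
        refine Finset.sum_le_sum fun x _ => ?_
        rcases hcover x with rfl | ⟨p, hp, hx⟩
        · rw [if_pos rfl]
          exact le_self_add
        · refine le_trans ?_ le_add_self
          refine le_trans ?_ (Finset.single_le_sum (fun _ _ => zero_le)
            (show p ∈ K by simpa [hK] using hp))
          rw [if_pos hx]
    _ = T.label w + ∑ p ∈ K, P p.1 p.2 := by
        rw [Finset.sum_add_distrib, Finset.sum_comm, Finset.sum_ite_eq' Finset.univ w,
          if_pos (Finset.mem_univ w)]
        congr 1
        refine Finset.sum_congr rfl fun p hp => ?_
        rw [← T.part p.1 (by simp [hK] at hp; exact hp.1), Finset.sum_filter]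

section Construction

variable {n : ℕ} {M : Multiset X} {P : Fin n → Bool → Multiset X}

theorem GammaArc.compl (hM : ∀ i b, P i b + P i (!b) = M) {p q : Fin n × Bool}
    (h : GammaArc P p q) : GammaArc P (q.1, !q.2) (p.1, !p.2) := by
  refine ⟨h.1.symm, ?_⟩
  have h2 : P q.1 q.2 + P q.1 (!q.2) < P q.1 q.2 + P p.1 (!p.2) := by
    rw [hM, ← hM p.1 p.2]
    exact add_lt_add_left h.2 _
  exact lt_of_add_lt_add_left h2

/-- There is a vertex on the far side of every edge, as seen from a part `P i b` that has an arc
to one part of every split represented by the tree. -/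
theorem SplitTree.exists_sink {V : Type} [Nonempty V] [Fintype V] {J : Finset (Fin n)}
    (T : SplitTree M P J V) (hthin : IsThinSubgraph P (GammaArc P)) (hne : ∀ i b, P i b ≠ 0)
    {u : Fin n × Bool} {c : Fin n → Bool} (hc : ∀ j ∈ J, GammaArc P u (j, c j)) :
    ∃ w, ∀ j ∈ J, Side T.G (T.ends j (c j)) (T.ends j !(c j)) w := by
  rcases J.eq_empty_or_nonempty with rfl | hJ
  · exact ⟨Classical.arbitrary V, by simp⟩
  obtain ⟨j, hj, hmin⟩ := J.exists_min_image
    (fun j => (Finset.univ.filter (Side T.G (T.ends j (c j)) (T.ends j !(c j)))).card) hJ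
  refine ⟨T.ends j (c j), fun k hk => ?_⟩
  by_contra hnot
  have hkj : k ≠ j := by
    rintro rfl
    exact hnot (Side.self _ _)
  by_cases hs : Side T.G (T.ends j (c j)) (T.ends j !(c j)) (T.ends k (c k))
  · refine absurd (hmin k hk) (not_le_of_gt (Finset.card_lt_card ?_))
    rw [Finset.ssubset_iff_of_subset]
    · exact ⟨T.ends j (c j), by simpa using Side.self _ _, by simpa using hnot⟩
    · intro x hx
      simp only [Finset.mem_filter, Finset.mem_univ, true_and] at hx ⊢
      exact Side.trans_of_not hs (Or.inl hnot) hx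
  · rw [T.not_side_ends_iff hj] at hs
    have harc : GammaArc P (k, c k) (j, !c j) := by
      refine T.gammaArc_of_side_subset hne hk hj hkj fun x hx => ?_
      rw [Bool.not_not]
      exact Side.trans_of_not hs (Or.inr hnot) hx
    have h' : GammaArc P u (j, !c j) := ⟨(hc j hj).1, (hc k hk).2.trans harc.2⟩
    have := (hthin.unique (hc j hj).1 (hc j hj) h').2
    simp at this

theorem exists_splitTree_of_star (hne : ∀ i b, P i b ≠ 0)
    (hM : ∀ i b, P i b + P i (!b) = M) (hthin : IsThinSubgraph P (GammaArc P))
    (hstar : ∀ F, IsStar P F → ∑ p ∈ F, P p.1 p.2 ≤ M) (J : Finset (Fin n)) :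
    ∃ (V : Type) (_ : Fintype V) (_ : Nonempty V), Nonempty (SplitTree M P J V) := by
  induction J using Finset.strongInduction with
  | H J ih =>
  rcases J.eq_empty_or_nonempty with rfl | hJ
  · refine ⟨Unit, inferInstance, inferInstance, ⟨⟨⊥, fun _ => M, fun _ _ => (),
      fun _ _ => .refl, ?_, ?_, ?_, ?_, ?_, ?_, ?_⟩⟩⟩ <;> simp
  obtain ⟨⟨i, b⟩, hib, hmin⟩ := (J ×ˢ (Finset.univ : Finset Bool)).exists_min_image
    (fun p => (P p.1 p.2).card) (hJ.product Finset.univ_nonempty)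
  have hi : i ∈ J := (Finset.mem_product.1 hib).1
  have hterm : ∀ j ∈ J, ∀ c, ¬ GammaArc P (j, c) (i, b) := fun j hj c h =>
    absurd (hmin (j, c) (by simpa using hj)) (not_le_of_gt (Multiset.card_lt_card h.2))
  have hc : ∀ j, ∃ c, j ∈ J.erase i → GammaArc P (i, b) (j, c) := by
    intro j
    by_cases hj : j ∈ J.erase i
    · have hij := (Finset.ne_of_mem_erase hj).symm
      obtain ⟨x, y, hxy⟩ := hthin.2 i j hij
      by_cases hx : b = x
      · exact ⟨y, fun _ => (hxy b y).1.2 ⟨hx, rfl⟩⟩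
      · refine absurd ((hxy b !y).2.2 ⟨rfl, ?_⟩) (hterm j (Finset.mem_of_mem_erase hj) _)
        cases b <;> cases x <;> simp_all
    · exact ⟨true, fun h => absurd h hj⟩
  choose c hc using hc
  obtain ⟨V, _, _, ⟨T⟩⟩ := ih _ (Finset.erase_ssubset hi)
  obtain ⟨w, hw⟩ := T.exists_sink hthin hne hc
  set K : Finset (Fin n × Bool) := {p | p.1 ∈ J.erase i ∧ T.ends p.1 (!p.2) = w} with hK
  have hKmem : ∀ p ∈ K, p.1 ∈ J.erase i ∧ T.ends p.1 (!p.2) = w := fun p hp => by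
    simpa only [hK, Finset.mem_filter, Finset.mem_univ, true_and] using hp
  have hKc : ∀ p ∈ K, (!p.2) = c p.1 := by
    intro p hp
    obtain ⟨hpJ, hpw⟩ := hKmem p hp
    by_contra h
    have h' : p.2 = c p.1 := by cases h1 : p.2 <;> cases h2 : c p.1 <;> simp_all
    have := hw p.1 hpJ
    rw [← hpw, ← h'] at this
    exact T.bridge _ _ (T.adj p.1 hpJ p.2) this
  have hKM := T.le_label_add_sum w
  rw [← hK] at hKM
  have hiK : (i, b) ∉ K := fun h => Finset.notMem_erase i J (hKmem _ h).1
  have hstarK : IsStar P (insert (i, b) K) := by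
    have harc : ∀ p ∈ K, GammaArc P (i, b) (p.1, !p.2) := fun p hp => by
      rw [hKc p hp]
      exact hc p.1 (hKmem p hp).1
    intro p hp q hq hpq
    rcases Finset.mem_insert.1 hp with rfl | hp <;> rcases Finset.mem_insert.1 hq with rfl | hq
    · exact absurd rfl hpq
    · exact harc q hq
    · simpa using (harc p hp).compl hM
    · obtain ⟨hpJ, hpw⟩ := hKmem p hp
      obtain ⟨hqJ, hqw⟩ := hKmem q hq
      have hpq1 : p.1 ≠ q.1 := by
        intro h
        refine hpq (Prod.ext h ?_)
        have h1 := hKc p hp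
        rw [h, ← hKc q hq] at h1
        simpa using h1
      have hne' : T.ends p.1 p.2 ≠ T.ends q.1 q.2 := by
        intro h
        exact hpq1 (T.inj p.1 hpJ q.1 hqJ p.2 q.2 h (hpw.trans hqw.symm))
      refine T.gammaArc_of_side_subset (b := p.2) (c := !q.2) hne hpJ hqJ hpq1 fun x hx => ?_
      have hap := T.adj p.1 hpJ p.2
      have haq := T.adj q.1 hqJ q.2
      rw [Bool.not_not, ← T.not_side_ends_iff hqJ]
      rw [hpw] at hx hap
      rw [hqw] at haq ⊢
      exact T.side_disjoint hap.symm haq.symm hne' hx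
  have hsum := hstar _ hstarK
  rw [Finset.sum_insert hiK] at hsum
  have hA : P i b ≤ T.label w := le_of_add_le_add_right (hsum.trans hKM)
  refine ⟨Option V, inferInstance, inferInstance, ?_⟩
  have := T.exists_insert (Finset.notMem_erase i J) hA (hne i b) (hM i b) ?_
  · rwa [Finset.insert_erase hi] at this
  intro hl
  rw [hl] at hKM
  have hK1 : 1 < K.card := by
    by_contra hcard
    have : Nonempty (Fin n × Bool) := ⟨(i, b)⟩
    rcases Finset.card_le_one_iff_subset_singleton.1 (not_lt.1 hcard) with ⟨p, hp⟩
    rcases Finset.subset_singleton_iff.1 hp with h0 | h1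
    · rw [h0, Finset.sum_empty, add_zero, ← hM i b] at hKM
      have : P i (!b) ≤ 0 := by simpa using hKM
      exact hne i (!b) (le_antisymm this zero_le)
    · have hpK : p ∈ K := by rw [h1]; exact Finset.mem_singleton_self p
      rw [h1, Finset.sum_singleton, ← hM p.1 p.2, add_comm (P i b)] at hKM
      have harc := (hstarK (i, b) (Finset.mem_insert_self _ _) p (Finset.mem_insert_of_mem hpK)
        (by rintro rfl; exact hiK hpK)).2
      exact absurd (le_of_add_le_add_left hKM) (not_le_of_gt harc)
  obtain ⟨p, hp, q, hq, hpq⟩ := Finset.one_lt_card.1 hK1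
  obtain ⟨hpJ, hpw⟩ := hKmem p hp
  obtain ⟨hqJ, hqw⟩ := hKmem q hq
  refine ⟨T.ends p.1 p.2, T.ends q.1 q.2, ?_, ?_, ?_⟩
  · rw [← hpw]
    exact (T.adj p.1 hpJ p.2).symm
  · rw [← hqw]
    exact (T.adj q.1 hqJ q.2).symm
  · intro h
    have h1 : p.1 = q.1 := T.inj p.1 hpJ q.1 hqJ p.2 q.2 h (hpw.trans hqw.symm)
    refine hpq (Prod.ext h1 ?_)
    have h2 := hKc p hp
    rw [h1, ← hKc q hq] at h2
    simpa using h2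

end Construction

theorem exists_subset_card_le_of_lt_sum {α : Type} (F : Finset α) (f : α → ℕ) {m : ℕ}
    (h : m < ∑ p ∈ F, f p) : ∃ F' ⊆ F, F'.card ≤ m + 1 ∧ m < ∑ p ∈ F', f p := by
  by_cases hc : m + 1 ≤ (F.filter fun p => f p ≠ 0).card
  · obtain ⟨F', hF', hcard⟩ := Finset.exists_subset_card_eq hc
    refine ⟨F', hF'.trans (Finset.filter_subset _ _), hcard.le, ?_⟩
    have : F'.card • 1 ≤ ∑ p ∈ F', f p := Finset.card_nsmul_le_sum _ _ _ fun p hp =>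
      Nat.one_le_iff_ne_zero.2 (Finset.mem_filter.1 (hF' hp)).2
    simp only [smul_eq_mul, mul_one] at this
    omega
  · refine ⟨_, Finset.filter_subset _ _, (not_le.1 hc).le, ?_⟩
    rwa [Finset.sum_filter_ne_zero]

theorem count_le_delta_add_one [DecidableEq X] (M : Multiset X) (x : X) :
    M.count x ≤ delta M + 1 := by
  by_cases hx : x ∈ M
  · have := Finset.single_le_sum (f := fun x => M.count x - 1) (fun _ _ => Nat.zero_le _)
      (Multiset.mem_toFinset.2 hx)
    unfold delta
    omega
  · simp [Multiset.count_eq_zero_of_notMem hx]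

/-- Corollary: the conjecture holds for thin split systems.
Suppose `𝔖 = {S₁, …, Sₙ}` is a thin split system on `M` (i.e., `Γ(𝔖)` is a thin
subgraph of itself). Then `𝔖` is compatible iff every submultiset of `𝔖` of size at
most `Δ(M) + 2` is compatible. -/
theorem stmt10 {X : Type} [DecidableEq X] (M : Multiset X) {n : ℕ}
    (P : Fin n → Bool → Multiset X)
    (hne : ∀ i b, P i b ≠ 0) (hsum : ∀ i, P i true + P i false = M)
    (hthin : IsThinSubgraph P (GammaArc P)) :
    Compatible M (splitSystemOf P) ↔
      ∀ 𝔖' : Multiset (Sym2 (Multiset X)), 𝔖' ≤ splitSystemOf P →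
        Multiset.card 𝔖' ≤ delta M + 2 → Compatible M 𝔖' := by
  have hM : ∀ i b, P i b + P i (!b) = M := by
    intro i b
    cases b
    · rw [add_comm]; exact hsum i
    · exact hsum i
  constructor
  · rintro ⟨T, hT⟩ 𝔖' h𝔖' -
    obtain ⟨T⟩ := T.exists_splitTree (J := Finset.univ) hT
    obtain ⟨J, -, rfl⟩ := exists_subset_of_le_map _ 𝔖' Finset.univ h𝔖'
    obtain ⟨V, _, _, ⟨T'⟩⟩ := exists_splitTree_of_star hne hM hthin
      (fun F hF => T.sum_star_le hne hthin (fun p _ => Finset.mem_univ p.1) hF) J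
    exact T'.compatible
  · intro h
    have hstar : ∀ F, IsStar P F → ∑ p ∈ F, P p.1 p.2 ≤ M := by
      intro F hF
      by_contra hnot
      rw [Multiset.le_iff_count] at hnot
      push Not at hnot
      obtain ⟨x, hx⟩ := hnot
      rw [Multiset.count_sum'] at hx
      obtain ⟨F', hF', hcard, hlt⟩ := exists_subset_card_le_of_lt_sum F _ hx
      have hJ : (F'.image Prod.fst).card ≤ delta M + 2 := by
        have := count_le_delta_add_one M x
        have := Finset.card_image_le (s := F') (f := Prod.fst)
        omega
      obtain ⟨T, hT⟩ := h ((F'.image Prod.fst).val.map fun i => s(P i true, P i false))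
        (Multiset.map_le_map (Finset.val_le_iff.2 (Finset.subset_univ _))) (by rwa [Multiset.card_map])
      obtain ⟨T⟩ := T.exists_splitTree hT
      have hle := T.sum_star_le hne hthin (fun p hp => Finset.mem_image_of_mem _ hp)
        (fun p hp q hq => hF p (hF' hp) q (hF' hq))
      have := Multiset.le_iff_count.1 hle x
      rw [Multiset.count_sum'] at this
      omega
    obtain ⟨V, _, _, ⟨T⟩⟩ := exists_splitTree_of_star hne hM hthin hstar Finset.univ
    exact T.compatible
end

section
/- Suppose that 𝔖 is a split system on a finite multiset 𝓜 in which every split has the same size. Then 𝔖 is compatible if and only if every submultiset of 𝔖 of size at most Δ(𝓜)+2 is compatible. -/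
open scoped Classical

/-- The vertices on the side of `u` after deleting the edge `{u, v}`. -/
def sideSet {V : Type*} (G : SimpleGraph V) (u v : V) : Set V :=
  {w | (G.deleteEdges {s(u, v)}).Reachable u w}

namespace SimpleGraph

variable {V : Type*} {G : SimpleGraph V} {u v a b : V}

lemma mem_sideSet_self (G : SimpleGraph V) (u v : V) : u ∈ sideSet G u v :=
  Reachable.refl u

lemma mem_sideSet_of_adj (ha : a ∈ sideSet G u v) (hab : G.Adj a b) (hne : s(a, b) ≠ s(u, v)) :
    b ∈ sideSet G u v :=
  Reachable.trans ha (Adj.reachable (by simpa [deleteEdges_adj] using ⟨hab, by simpa using hne⟩))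

lemma mem_sideSet_iff_of_adj (hab : G.Adj a b) (hne : s(a, b) ≠ s(u, v)) :
    a ∈ sideSet G u v ↔ b ∈ sideSet G u v :=
  ⟨fun h => mem_sideSet_of_adj h hab hne,
    fun h => mem_sideSet_of_adj h hab.symm (by rwa [Sym2.eq_swap])⟩

lemma sideSet_subset {S : Set V} (hu : u ∈ S)
    (hS : ∀ x y, x ∈ S → x ∈ sideSet G u v → G.Adj x y → s(x, y) ≠ s(u, v) → y ∈ S) :
    sideSet G u v ⊆ S := by
  intro w hw
  have key : w ∈ S ∧ w ∈ sideSet G u v := by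
    have hw' := (reachable_iff_reflTransGen u w).1 hw
    induction hw' with
    | refl => exact ⟨hu, mem_sideSet_self G u v⟩
    | @tail x y hux hxy ih =>
      have hadj : G.Adj x y ∧ s(x, y) ≠ s(u, v) := by
        rw [deleteEdges_adj] at hxy
        simpa only [Set.mem_singleton_iff] using hxy
      obtain ⟨h1, h2⟩ := ih ((reachable_iff_reflTransGen u x).2 hux)
      exact ⟨hS x y h1 h2 hadj.1 hadj.2, mem_sideSet_of_adj h2 hadj.1 hadj.2⟩
  exact key.1

lemma IsAcyclic.notMem_sideSet (hG : G.IsAcyclic) (huv : G.Adj u v) : v ∉ sideSet G u v :=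
  isBridge_iff.1 (isAcyclic_iff_forall_adj_isBridge.1 hG huv)

/-- The two sides of an edge of a tree are complementary. -/
lemma IsTree.compl_sideSet (hG : G.IsTree) (huv : G.Adj u v) :
    (sideSet G u v)ᶜ = sideSet G v u := by
  ext w
  constructor
  · intro hw
    have key : w ∈ sideSet G u v ∨ w ∈ sideSet G v u := by
      have hr := (reachable_iff_reflTransGen u w).1 (hG.connected.preconnected u w)
      clear hw
      induction hr with
      | refl => exact Or.inl (mem_sideSet_self G u v)
      | @tail x y _ hxy ih =>
        by_cases he : s(x, y) = s(u, v)
        · rcases Sym2.eq_iff.1 he with ⟨-, rfl⟩ | ⟨-, rfl⟩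
          · exact Or.inr (mem_sideSet_self ..)
          · exact Or.inl (mem_sideSet_self ..)
        · refine ih.imp (fun h => mem_sideSet_of_adj h hxy he) (fun h => ?_)
          exact mem_sideSet_of_adj h hxy (by rwa [Sym2.eq_swap (a := v)])
    exact key.resolve_left hw
  · intro hw hw'
    apply hG.isAcyclic.notMem_sideSet huv
    have hw2 : (G.deleteEdges {s(u, v)}).Reachable v w := by
      have := hw
      rwa [sideSet, Set.mem_ofPred_eq, Sym2.eq_swap] at this
    exact Reachable.trans hw' hw2.symm

lemma sideSet_subset_sideSet (hu : u ∈ sideSet G a b) (ha : a ∉ sideSet G u v)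
    (hb : b ∉ sideSet G u v) : sideSet G u v ⊆ sideSet G a b := by
  refine sideSet_subset hu fun x y hx hxs hxy hne => ?_
  refine mem_sideSet_of_adj hx hxy fun he => ?_
  rcases Sym2.eq_iff.1 he with ⟨rfl, -⟩ | ⟨rfl, -⟩
  · exact ha hxs
  · exact hb hxs

end SimpleGraph

namespace MTree

open SimpleGraph

variable {X : Type} {M : Multiset X} (T : MTree X M) {u v a b : Fin T.n}

lemma isTree : T.G.IsTree := ⟨T.connected, T.acyclic⟩

lemma part_eq_sum (u v : Fin T.n) :
    T.part u v = ∑ w ∈ Finset.univ.filter (fun w => w ∈ sideSet T.G u v), T.label w := by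
  rw [part]
  congr!

lemma part_le_part (h : sideSet T.G u v ⊆ sideSet T.G a b) : T.part u v ≤ T.part a b := by
  rw [part_eq_sum, part_eq_sum]
  refine Finset.sum_le_sum_of_subset fun w hw => ?_
  simp only [Finset.mem_filter, Finset.mem_univ, true_and] at hw ⊢
  exact h hw

lemma part_add_part (huv : T.G.Adj u v) : T.part u v + T.part v u = M := by
  rw [part_eq_sum, part_eq_sum, ← T.isTree.compl_sideSet huv]
  simp only [Set.mem_compl_iff]
  exact (Finset.sum_filter_add_sum_filter_not _ _ _).trans T.m1

lemma exists_adj_ne_of_label_eq_zero (huv : T.G.Adj u v) (hu : T.label u = 0) :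
    ∃ w₁ w₂, T.G.Adj u w₁ ∧ T.G.Adj u w₂ ∧ w₁ ≠ v ∧ w₂ ≠ v ∧ w₁ ≠ w₂ := by
  have h12 : ¬ (T.G.degree u = 1 ∨ T.G.degree u = 2) := fun h => T.m2 u h hu
  have h0 : 0 < T.G.degree u := (T.G.degree_pos_iff_exists_adj u).2 ⟨v, huv⟩
  have hcard : 1 < ((T.G.neighborFinset u).erase v).card := by
    rw [Finset.card_erase_of_mem (by simpa using huv), card_neighborFinset_eq_degree]
    omega
  obtain ⟨w₁, h₁, w₂, h₂, hne⟩ := Finset.one_lt_card.1 hcard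
  simp only [Finset.mem_erase, mem_neighborFinset] at h₁ h₂
  exact ⟨w₁, w₂, h₁.2, h₂.2, h₁.1, h₂.1, hne⟩

/-- The sides of the further edges at `u`, away from `u`, are contained in the side of `u`. -/
lemma sideSet_subset_of_adj (huv : T.G.Adj u v) {w : Fin T.n} (huw : T.G.Adj u w) (hne : w ≠ v) :
    sideSet T.G w u ⊆ sideSet T.G u v := by
  have hu : u ∉ sideSet T.G w u := T.acyclic.notMem_sideSet huw.symm
  refine sideSet_subset_sideSet (mem_sideSet_of_adj (mem_sideSet_self ..) huw ?_) hu ?_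
  · rw [Ne, Sym2.eq_iff]
    exact fun h => h.elim (fun h => hne h.2) (fun h => huw.ne h.2.symm)
  · rwa [← mem_sideSet_iff_of_adj huv]
    intro h
    rcases Sym2.eq_iff.1 h with ⟨h, -⟩ | ⟨-, h⟩
    · exact huw.ne h
    · exact hne h.symm

lemma part_ne_zero (huv : T.G.Adj u v) : T.part u v ≠ 0 := by
  induction hn : (sideSet T.G u v).ncard using Nat.strong_induction_on generalizing u v with
  | _ n ih =>
    by_cases hu : T.label u = 0
    · obtain ⟨w, -, huw, -, hwv, -, -⟩ := T.exists_adj_ne_of_label_eq_zero huv hu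
      have hsub := T.sideSet_subset_of_adj huv huw hwv
      have hlt : (sideSet T.G w u).ncard < n := by
        rw [← hn]
        refine Set.ncard_lt_ncard ((Set.ssubset_iff_of_subset hsub).2
          ⟨u, mem_sideSet_self .., T.acyclic.notMem_sideSet huw.symm⟩) (Set.toFinite _)
      intro h0
      exact ih _ hlt huw.symm rfl (le_antisymm (h0 ▸ T.part_le_part hsub) (Multiset.zero_le _))
    · intro h0
      refine hu (le_antisymm (h0 ▸ ?_) (Multiset.zero_le _))
      rw [part_eq_sum]
      exact Finset.single_le_sum (f := T.label) (fun _ _ => Multiset.zero_le _)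
        (by simpa using mem_sideSet_self ..)

/-- Properly nested sides of distinct edges carry label multisets of different sizes. -/
lemma card_part_lt_card_part (huv : T.G.Adj u v) (hab : T.G.Adj a b) (hne : s(u, v) ≠ s(a, b))
    (hu : u ∈ sideSet T.G a b) (ha : a ∉ sideSet T.G u v) :
    (T.part u v).card < (T.part a b).card := by
  have hb : b ∉ sideSet T.G u v := by rwa [← mem_sideSet_iff_of_adj hab hne.symm]
  have hsub : sideSet T.G u v ⊆ sideSet T.G a b := sideSet_subset_sideSet hu ha hb
  have hv : v ∈ sideSet T.G a b := mem_sideSet_of_adj hu huv hne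
  have hbv : b ≠ v := fun h => T.acyclic.notMem_sideSet hab (h ▸ hv)
  suffices h : ∃ S : Finset (Fin T.n), (∀ x ∈ S, x ∈ sideSet T.G a b ∧ x ∉ sideSet T.G u v) ∧
      ∑ x ∈ S, T.label x ≠ 0 by
    obtain ⟨S, hS, hS0⟩ := h
    have hdisj : Disjoint (Finset.univ.filter (fun w => w ∈ sideSet T.G u v)) S :=
      Finset.disjoint_left.2 fun x hx hxS => (hS x hxS).2 (by simpa using hx)
    have hle : T.part u v + ∑ x ∈ S, T.label x ≤ T.part a b := by
      rw [part_eq_sum, part_eq_sum, ← Finset.sum_union hdisj]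
      refine Finset.sum_le_sum_of_subset fun x hx => ?_
      simp only [Finset.mem_union, Finset.mem_filter, Finset.mem_univ, true_and] at hx ⊢
      exact hx.elim (fun h => hsub h) (fun h => (hS x h).1)
    have := Multiset.card_le_card hle
    have := Multiset.card_pos.2 hS0
    rw [Multiset.card_add] at *
    omega
  by_cases hlv : T.label v = 0
  · obtain ⟨w₁, w₂, hw₁, hw₂, hu₁, hu₂, hw⟩ := T.exists_adj_ne_of_label_eq_zero huv.symm hlv
    obtain ⟨w, hvw, hwu, hbw⟩ : ∃ w, T.G.Adj v w ∧ w ≠ u ∧ b ∉ sideSet T.G w v := by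
      by_cases hb₁ : b ∈ sideSet T.G w₁ v
      · refine ⟨w₂, hw₂, hu₂, fun hb₂ => ?_⟩
        have := T.sideSet_subset_of_adj hw₁ hw₂ hw.symm hb₂
        rw [← T.isTree.compl_sideSet hw₁.symm] at this
        exact this hb₁
      · exact ⟨w₁, hw₁, hu₁, hb₁⟩
    have hwv : w ∉ sideSet T.G v w := T.acyclic.notMem_sideSet hvw
    have hne' : s(v, w) ≠ s(a, b) := by
      intro h
      rcases Sym2.eq_iff.1 h with ⟨-, h⟩ | ⟨h, -⟩
      · exact hbw (h ▸ mem_sideSet_self ..)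
      · exact hbv h.symm
    have haw : a ∉ sideSet T.G w v := by
      rwa [mem_sideSet_iff_of_adj hab]
      rw [Sym2.eq_swap (a := w)]
      exact hne'.symm
    have hsub₁ : sideSet T.G w v ⊆ sideSet T.G a b :=
      sideSet_subset_sideSet (mem_sideSet_of_adj hv hvw hne') haw hbw
    have hsub₂ := T.sideSet_subset_of_adj huv.symm hvw hwu
    rw [← T.isTree.compl_sideSet huv] at hsub₂
    refine ⟨Finset.univ.filter (fun x => x ∈ sideSet T.G w v), fun x hx => ?_,
      by rw [← part_eq_sum]; exact T.part_ne_zero hvw.symm⟩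
    have hx' : x ∈ sideSet T.G w v := by simpa using hx
    exact ⟨hsub₁ hx', hsub₂ hx'⟩
  · refine ⟨{v}, fun x hx => ?_, by simpa using hlv⟩
    rw [Finset.mem_singleton.1 hx]
    exact ⟨hv, T.acyclic.notMem_sideSet huv⟩

/-- Sides of distinct edges that carry equally many labels, and at most half of them,
are disjoint. -/
lemma disjoint_sideSet (huv : T.G.Adj u v) (hab : T.G.Adj a b) (hne : s(u, v) ≠ s(a, b))
    {k : ℕ} (hk₁ : (T.part u v).card = k) (hk₂ : (T.part a b).card = k)
    (hk₃ : k ≤ (T.part v u).card) : Disjoint (sideSet T.G u v) (sideSet T.G a b) := by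
  have hne' : s(v, u) ≠ s(a, b) := by rwa [Sym2.eq_swap]
  by_cases ha : a ∈ sideSet T.G u v
  · exfalso
    by_cases hu : u ∈ sideSet T.G a b
    · have hv : v ∈ sideSet T.G a b := mem_sideSet_of_adj hu huv hne
      have := T.card_part_lt_card_part huv.symm hab hne' hv
        (by rw [← T.isTree.compl_sideSet huv]; exact fun h => h ha)
      omega
    · have := T.card_part_lt_card_part hab huv hne.symm ha hu
      omega
  · by_cases hu : u ∈ sideSet T.G a b
    · have := T.card_part_lt_card_part huv hab hne hu ha
      omega
    · have hu' : u ∈ sideSet T.G b a := by rwa [← T.isTree.compl_sideSet hab]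
      have hb : b ∉ sideSet T.G u v := by rwa [← mem_sideSet_iff_of_adj hab hne.symm]
      have := sideSet_subset_sideSet hu' hb ha
      rw [← T.isTree.compl_sideSet hab] at this
      exact Set.disjoint_left.2 fun x hx => this hx

end MTree

/-- In a compatible system of splits of equal size, the small parts are jointly contained
in `M`. -/
lemma Compatible.sum_map_le {X : Type} {M : Multiset X} {𝔖 : Multiset (Sym2 (Multiset X))}
    (h : Compatible M 𝔖) {k : ℕ} (hk : ∀ S ∈ 𝔖, splitSize S = k)
    {f : Sym2 (Multiset X) → Multiset X} (hf : ∀ S, f S ∈ S ∧ (f S).card = splitSize S) :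
    (𝔖.map f).sum ≤ M := by
  obtain ⟨T, rfl⟩ := h
  have hor : ∀ e : Sym2 (Fin T.n), ∃ p : Fin T.n × Fin T.n, e ∈ T.G.edgeFinset →
      e = s(p.1, p.2) ∧ T.G.Adj p.1 p.2 ∧
      f (Sym2.lift ⟨fun u v => s(T.part u v, T.part v u), fun u v => Sym2.eq_swap⟩ e) =
        T.part p.1 p.2 ∧ (T.part p.1 p.2).card = k ∧ k ≤ (T.part p.2 p.1).card := by
    intro e
    induction e using Sym2.ind with
    | _ u v =>
      by_cases he : s(u, v) ∈ T.G.edgeFinset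
      · have hadj : T.G.Adj u v := by simpa using he
        have hmem : s(T.part u v, T.part v u) ∈ T.splits :=
          Multiset.mem_map.2 ⟨s(u, v), he, rfl⟩
        have hsz := hk _ hmem
        obtain ⟨h₁, h₂⟩ := hf s(T.part u v, T.part v u)
        rw [hsz] at h₂
        have hmin : min (T.part u v).card (T.part v u).card = k := hsz
        rcases Sym2.mem_iff.1 h₁ with h₁ | h₁
        · exact ⟨(u, v), fun _ => ⟨rfl, hadj, h₁, h₁ ▸ h₂, hmin ▸ min_le_right _ _⟩⟩
        · exact ⟨(v, u), fun _ => ⟨Sym2.eq_swap, hadj.symm, h₁, h₁ ▸ h₂,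
            hmin ▸ min_le_left _ _⟩⟩
      · exact ⟨(u, v), fun h => absurd h he⟩
  choose p hp using hor
  have hsum : (T.splits.map f).sum =
      ∑ e ∈ T.G.edgeFinset, T.part (p e).1 (p e).2 := by
    rw [MTree.splits, Multiset.map_map]
    exact Finset.sum_congr rfl fun e he => (hp e he).2.2.1
  rw [hsum]
  refine le_of_le_of_eq ?_ T.m1
  simp only [MTree.part_eq_sum]
  rw [← Finset.sum_biUnion]
  · exact Finset.sum_le_sum_of_subset (Finset.subset_univ _)
  · intro e he e' he' hne
    obtain ⟨h₁, h₂, -, h₃, h₄⟩ := hp e he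
    obtain ⟨h₁', h₂', -, h₃', -⟩ := hp e' he'
    have hd := T.disjoint_sideSet h₂ h₂' (by rwa [← h₁, ← h₁']) h₃ h₃' h₄
    refine Finset.disjoint_left.2 fun x hx hx' => ?_
    exact Set.disjoint_left.1 hd (by simpa using hx) (by simpa using hx')

open SimpleGraph in
lemma sideSet_starGraph {n : ℕ} (i : Fin n) :
    sideSet (starGraph (0 : Fin (n + 1))) i.succ 0 = {i.succ} := by
  refine Set.Subset.antisymm (sideSet_subset rfl fun x y hx _ hxy hne => ?_)
    (by simpa using mem_sideSet_self ..)
  rw [Set.mem_singleton_iff] at hx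
  subst hx
  rw [starGraph_adj] at hxy
  rcases hxy.2 with h | h
  · exact absurd h (Fin.succ_ne_zero i)
  · exact absurd (h ▸ rfl) hne

open SimpleGraph in
/-- Splits whose parts of one kind jointly fit into `M` are represented by a star. -/
lemma compatible_of_sum_map_le {X : Type} {M : Multiset X} {𝔖 : Multiset (Sym2 (Multiset X))}
    (hsys : IsSplitSystem M 𝔖) {f : Sym2 (Multiset X) → Multiset X} (hf : ∀ S, f S ∈ S)
    (hle : (𝔖.map f).sum ≤ M) (htwo : 𝔖.card = 2 → (𝔖.map f).sum ≠ M) :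
    Compatible M 𝔖 := by
  have hf' : ∀ S ∈ 𝔖, f S ≠ 0 ∧ f S ≠ M ∧ ∀ B, f S + B = M → S = s(f S, B) := by
    intro S hS
    obtain ⟨A, B, hAB, hA, hB, hM⟩ := hsys S hS
    have hfS := hf S
    generalize f S = C at hfS ⊢
    subst hAB hM
    rcases Sym2.mem_iff.1 hfS with rfl | rfl
    · exact ⟨hA, fun h => hB (by simpa using h), fun D hD => by rw [add_left_cancel hD]⟩
    · refine ⟨hB, fun h => hA (by simpa using h), fun D hD => ?_⟩
      rw [add_comm A] at hD
      rw [add_left_cancel hD, Sym2.eq_swap]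
  obtain ⟨L, rfl⟩ : ∃ L : List (Sym2 (Multiset X)), 𝔖 = (L : Multiset _) :=
    ⟨𝔖.toList, 𝔖.coe_toList.symm⟩
  obtain ⟨R, hR⟩ := Multiset.le_iff_exists_add.1 hle
  set A : Fin L.length → Multiset X := fun i => f (L.get i) with hA
  have hAmem : ∀ i, L.get i ∈ (L : Multiset (Sym2 (Multiset X))) := fun i => L.get_mem i
  have hAsum : ∑ i, A i = (Multiset.map f (L : Multiset _)).sum := by
    rw [Multiset.map_coe, Multiset.sum_coe, ← List.sum_ofFn]
    congr 1
    exact (List.ofFn_getElem_eq_map L f)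
  let T : MTree X M :=
    { n := L.length + 1
      G := starGraph 0
      connected := connected_starGraph 0
      acyclic := isAcyclic_starGraph 0
      label := Fin.cons R A
      m1 := by
        rw [Fin.sum_univ_succ, Fin.cons_zero]
        simp only [Fin.cons_succ]
        rw [hAsum, hR, add_comm]
      m2 := by
        intro v
        refine Fin.cases ?_ (fun i _ => ?_) v
        · rw [Fin.cons_zero]
          rintro h rfl
          rw [add_zero] at hR
          have hd := degree_starGraph_center (r := (0 : Fin (L.length + 1)))
          rw [Fintype.card_fin, Nat.add_sub_cancel] at hd
          have h' : L.length = 1 ∨ L.length = 2 := by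
            rw [← hd]
            convert h
          rcases h' with h | h
          · obtain ⟨S, rfl⟩ := List.length_eq_one_iff.1 h
            exact (hf' S (by simp)).2.1 (by simpa using hR.symm)
          · exact htwo (by simpa using h) hR.symm
        · rw [Fin.cons_succ]
          exact (hf' _ (hAmem i)).1 }
  refine ⟨T, ?_⟩
  have hadj : ∀ i : Fin L.length, T.G.Adj i.succ 0 := fun i =>
    starGraph_adj.2 ⟨Fin.succ_ne_zero i, Or.inr rfl⟩
  have hpart : ∀ i : Fin L.length, T.part i.succ 0 = A i := by
    intro i
    rw [MTree.part_eq_sum]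
    have : (Finset.univ.filter fun w => w ∈ sideSet T.G i.succ 0) = {i.succ} := by
      ext w
      rw [show sideSet T.G i.succ 0 = {i.succ} from sideSet_starGraph i]
      simp
    rw [this, Finset.sum_singleton]
    rfl
  have hinj : Function.Injective fun i : Fin L.length => s(i.succ, (0 : Fin (L.length + 1))) := by
    intro i j hij
    simpa using hij
  have hedge : ∀ _ : Fintype T.G.edgeSet, T.G.edgeFinset = Finset.univ.map ⟨_, hinj⟩ := by
    intro _
    ext e
    induction e using Sym2.ind with
    | _ u v =>
      simp only [mem_edgeFinset, mem_edgeSet, Finset.mem_map, Finset.mem_univ, true_and,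
        Function.Embedding.coeFn_mk]
      constructor
      · intro h
        rcases (starGraph_adj.1 h) with ⟨hne, rfl | rfl⟩
        · obtain ⟨i, rfl⟩ := Fin.exists_succ_eq.2 hne.symm
          exact ⟨i, Sym2.eq_swap⟩
        · obtain ⟨i, rfl⟩ := Fin.exists_succ_eq.2 hne
          exact ⟨i, rfl⟩
      · rintro ⟨i, hi⟩
        exact (T.G.mem_edgeSet).1 (hi ▸ hadj i)
  rw [MTree.splits]
  refine (congrArg (fun s : Finset (Sym2 (Fin T.n)) => s.val.map _) (hedge _)).trans ?_
  rw [Finset.map_val, Multiset.map_map]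
  have hval : ∀ i : Fin L.length, s(T.part i.succ 0, T.part 0 i.succ) = L.get i := by
    intro i
    have h := T.part_add_part (hadj i)
    rw [hpart] at h ⊢
    exact ((hf' _ (hAmem i)).2.2 _ h).symm
  refine (Multiset.map_congr rfl fun i _ => hval i).trans ?_
  simp [Fin.univ_val_map]

/-- If the sum of a family of multisets is not contained in `M`, then neither is the sum of some
subfamily of at most `Δ(M) + 2` members. -/
lemma sum_map_le_of_forall_card_le {X α : Type} [DecidableEq X] {M : Multiset X}
    {𝔖 : Multiset α} {f : α → Multiset X}
    (h : ∀ 𝔖' ≤ 𝔖, 𝔖'.card ≤ delta M + 2 → (𝔖'.map f).sum ≤ M) : (𝔖.map f).sum ≤ M := by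
  rw [Multiset.le_iff_count]
  intro x
  by_contra! hlt
  rw [Multiset.count_sum] at hlt
  set 𝔗 := 𝔖.filter (fun S => x ∈ f S) with h𝔗
  have hmem : ∀ S ∈ 𝔗, S ∈ 𝔖 ∧ x ∈ f S := fun S hS => Multiset.mem_filter.1 hS
  have hcount : M.count x ≤ delta M + 1 := by
    by_cases hx : x ∈ M
    · have : M.count x - 1 ≤ delta M :=
        Finset.single_le_sum (f := fun y => M.count y - 1) (fun _ _ => Nat.zero_le _)
          (Multiset.mem_toFinset.2 hx)
      omega
    · rw [Multiset.count_eq_zero_of_notMem hx]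
      exact Nat.zero_le _
  have hlow : ∀ 𝔘 ≤ 𝔗, 𝔘.card ≤ (𝔘.map fun S => (f S).count x).sum := by
    intro 𝔘 h𝔘
    have := Multiset.card_nsmul_le_sum (s := 𝔘.map fun S => (f S).count x) (a := 1) (by
      intro y hy
      obtain ⟨S, hS, rfl⟩ := Multiset.mem_map.1 hy
      exact Multiset.one_le_count_iff_mem.2 (hmem S (Multiset.mem_of_le h𝔘 hS)).2)
    simpa using this
  by_cases hc : 𝔗.card ≤ M.count x
  · have hle := h 𝔗 (Multiset.filter_le _ _) (by omega)
    have := Multiset.le_iff_count.1 hle x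
    rw [Multiset.count_sum] at this
    have heq : (𝔖.map fun S => (f S).count x).sum = (𝔗.map fun S => (f S).count x).sum := by
      rw [← Multiset.filter_add_not (fun S => x ∈ f S) 𝔖, Multiset.map_add, Multiset.sum_add]
      simp only [h𝔗, add_eq_left]
      refine Multiset.sum_eq_zero fun y hy => ?_
      obtain ⟨S, hS, rfl⟩ := Multiset.mem_map.1 hy
      exact Multiset.count_eq_zero_of_notMem (Multiset.mem_filter.1 hS).2
    omega
  · obtain ⟨𝔘, h𝔘'⟩ := Multiset.card_pos_iff_exists_mem.1
      (show 0 < (𝔗.powersetCard (M.count x + 1)).card by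
        rw [Multiset.card_powersetCard]
        exact Nat.choose_pos (by omega))
    obtain ⟨h𝔘, hcard⟩ := Multiset.mem_powersetCard.1 h𝔘'
    have hle := h 𝔘 (h𝔘.trans (Multiset.filter_le _ _)) (by omega)
    have := Multiset.le_iff_count.1 hle x
    rw [Multiset.count_sum] at this
    have := hlow 𝔘 h𝔘
    omega

/-- Theorem: splits of equal size. Suppose `𝔖` is a split system
on `M` in which every split has the same size. Then `𝔖` is compatible iff every
submultiset of `𝔖` of size at most `Δ(M) + 2` is compatible. -/
theorem stmt11 {X : Type} [DecidableEq X] (M : Multiset X)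
    (𝔖 : Multiset (Sym2 (Multiset X))) (hsys : IsSplitSystem M 𝔖)
    (hsame : ∀ S ∈ 𝔖, ∀ S' ∈ 𝔖, splitSize S = splitSize S') :
    Compatible M 𝔖 ↔
      ∀ 𝔖' : Multiset (Sym2 (Multiset X)), 𝔖' ≤ 𝔖 →
        Multiset.card 𝔖' ≤ delta M + 2 → Compatible M 𝔖' := by
  have hsmall : ∀ S : Sym2 (Multiset X), ∃ C ∈ S, C.card = splitSize S := by
    intro S
    induction S using Sym2.ind with
    | _ A B =>
      change ∃ C, C ∈ s(A, B) ∧ C.card = min A.card B.card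
      rcases le_total A.card B.card with h | h
      · exact ⟨A, Sym2.mem_mk_left _ _, (min_eq_left h).symm⟩
      · exact ⟨B, Sym2.mem_mk_right _ _, (min_eq_right h).symm⟩
  choose f hf using hsmall
  obtain ⟨k, hk⟩ : ∃ k, ∀ S ∈ 𝔖, splitSize S = k := by
    rcases 𝔖.empty_or_exists_mem with rfl | ⟨S₀, hS₀⟩
    · exact ⟨0, by simp⟩
    · exact ⟨splitSize S₀, fun S hS => hsame S hS S₀ hS₀⟩
  have hf0 : ∀ S ∈ 𝔖, f S ≠ 0 := by
    intro S hS
    obtain ⟨A, B, rfl, hA, hB, -⟩ := hsys S hS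
    rcases Sym2.mem_iff.1 (hf s(A, B)).1 with h | h
    · exact h.trans_ne hA
    · exact h.trans_ne hB
  constructor
  · intro hc 𝔖' hle _
    rcases hle.eq_or_lt with rfl | hlt
    · exact hc
    obtain ⟨S, hS⟩ := Multiset.lt_iff_cons_le.1 hlt
    have hsum : f S + (𝔖'.map f).sum ≤ M := by
      obtain ⟨R, rfl⟩ := Multiset.le_iff_exists_add.1 hS
      refine le_trans ?_ (hc.sum_map_le hk hf)
      simp
    have hS0 := Multiset.card_pos.2 (hf0 S (Multiset.mem_of_le hS (Multiset.mem_cons_self _ _)))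
    refine compatible_of_sum_map_le (fun S' hS' => hsys S' (Multiset.mem_of_le hle hS'))
      (fun S => (hf S).1) ((Multiset.le_add_left _ _).trans hsum) fun _ heq => ?_
    have := Multiset.card_le_card hsum
    rw [heq, Multiset.card_add] at this
    omega
  · intro h
    by_cases htwo : 𝔖.card = 2
    · exact h 𝔖 le_rfl (by omega)
    · refine compatible_of_sum_map_le hsys (fun S => (hf S).1)
        (sum_map_le_of_forall_card_le fun 𝔖' hle hcard => ?_) fun h => absurd h htwo
      exact (h 𝔖' hle hcard).sum_map_le (fun S hS => hk S (Multiset.mem_of_le hle hS)) hf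
end

section
/- Let 𝓜 be a finite multiset and let A₁,…,A_k, k ≥ 2, be a partition of 𝓜 (i.e., nonempty submultisets whose multiset union is 𝓜). Let G be a graph whose vertex set is {Aᵢ : 1 ≤ i ≤ k} such that every edge {Aᵢ,Aⱼ}, i ≠ j, of G satisfies Aᵢ ∩ Aⱼ ≠ ∅. If G has c connected components, then Δ(𝓜) ≥ k − c. -/
open scoped Classical

/-- If the differences `f i - f j` over a finite set `P` of pairs determine which functions `f` are
constant along the edges of `G`, then `G` has at least `|V| - |P|` connected components. -/
theorem card_le_card_connectedComponent_add_card {V : Type*} [Fintype V] (G : SimpleGraph V)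
    (P : Finset (V × V))
    (h : ∀ f : V → ℝ, (∀ p ∈ P, f p.1 = f p.2) → ∀ i j, G.Adj i j → f i = f j) :
    Fintype.card V ≤ Nat.card G.ConnectedComponent + P.card := by
  let F : (V → ℝ) →ₗ[ℝ] (P → ℝ) :=
    LinearMap.pi fun p =>
      LinearMap.proj (R := ℝ) (φ := fun _ : V => ℝ) p.1.1 - LinearMap.proj p.1.2
  have hker : LinearMap.ker F ≤ LinearMap.ker (Matrix.toLin' (G.lapMatrix ℝ)) := by
    intro f hf
    rw [LinearMap.mem_ker, Matrix.toLin'_apply, G.lapMatrix_mulVec_eq_zero_iff_forall_adj]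
    refine h f fun p hp => ?_
    have hp' := congrFun (LinearMap.mem_ker.mp hf) ⟨p, hp⟩
    exact sub_eq_zero.mp hp'
  have hrank := LinearMap.finrank_range_add_finrank_ker F
  have hrange := Submodule.finrank_le (LinearMap.range F)
  have hle := Submodule.finrank_mono hker
  have hcard := G.card_connectedComponent_eq_finrank_ker_toLin'_lapMatrix
  rw [Module.finrank_fintype_fun_eq_card] at hrank hrange
  rw [Fintype.card_coe] at hrange
  rw [Nat.card_eq_fintype_card]
  omega

theorem card_filter_mem_le_count_sum {X ι : Type*} [DecidableEq X] [Fintype ι]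
    (A : ι → Multiset X) (x : X) :
    (Finset.univ.filter fun i => x ∈ A i).card ≤ (∑ i, A i).count x := by
  rw [Multiset.count_sum', Finset.card_filter]
  refine Finset.sum_le_sum fun i _ => ?_
  split_ifs with hi
  · exact Multiset.one_le_count_iff_mem.mpr hi
  · exact Nat.zero_le _

/-- Lemma. Let `A₁, …, A_k`, `k ≥ 2`, be a partition of the
multiset `M`, and let `G` be a graph on vertex set `{A₁, …, A_k}` each of whose edges
`{Aᵢ, Aⱼ}` satisfies `Aᵢ ∩ Aⱼ ≠ ∅`. If `G` has `c` connected components, then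
`Δ(M) ≥ k - c`. -/
theorem stmt12 {X : Type} [DecidableEq X] (M : Multiset X) (k : ℕ) (hk : 2 ≤ k)
    (A : Fin k → Multiset X) (hne : ∀ i, A i ≠ 0) (hsum : ∑ i, A i = M)
    (G : SimpleGraph (Fin k)) (hadj : ∀ i j, G.Adj i j → A i ∩ A j ≠ 0) :
    k - Nat.card G.ConnectedComponent ≤ delta M := by
  have hrep : ∀ x : X, ∃ r : Fin k, x ∈ M → x ∈ A r := by
    intro x
    by_cases hx : x ∈ M
    · rw [← hsum, Multiset.mem_sum] at hx
      obtain ⟨r, -, hr⟩ := hx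
      exact ⟨r, fun _ => hr⟩
    · exact ⟨⟨0, by omega⟩, fun h => absurd h hx⟩
  choose r hr using hrep
  have hmem : ∀ i x, x ∈ A i → x ∈ M := fun i x hx =>
    hsum ▸ Multiset.mem_sum.mpr ⟨i, Finset.mem_univ i, hx⟩
  let S : X → Finset (Fin k) := fun x => Finset.univ.filter fun i => x ∈ A i
  let P : Finset (Fin k × Fin k) :=
    M.toFinset.biUnion fun x => ((S x).erase (r x)).image fun i => (i, r x)
  have hP : P.card ≤ delta M := by
    refine Finset.card_biUnion_le.trans (Finset.sum_le_sum fun x hx => ?_)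
    refine Finset.card_image_le.trans ?_
    have hrx : r x ∈ S x :=
      Finset.mem_filter.mpr ⟨Finset.mem_univ _, hr x (Multiset.mem_toFinset.mp hx)⟩
    rw [Finset.card_erase_of_mem hrx, ← hsum]
    exact Nat.sub_le_sub_right (card_filter_mem_le_count_sum A x) 1
  have hconst : ∀ f : Fin k → ℝ, (∀ p ∈ P, f p.1 = f p.2) →
      ∀ i j, G.Adj i j → f i = f j := by
    intro f hf i j hij
    obtain ⟨x, hx⟩ := Multiset.exists_mem_of_ne_zero (hadj i j hij)
    rw [Multiset.mem_inter] at hx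
    have hfr : ∀ l, x ∈ A l → f l = f (r x) := by
      intro l hl
      by_cases hlr : l = r x
      · rw [hlr]
      · refine hf (l, r x) (Finset.mem_biUnion.mpr
          ⟨x, Multiset.mem_toFinset.mpr (hmem l x hl), Finset.mem_image.mpr ⟨l, ?_, rfl⟩⟩)
        exact Finset.mem_erase.mpr ⟨hlr, Finset.mem_filter.mpr ⟨Finset.mem_univ _, hl⟩⟩
    rw [hfr i hx.1, hfr j hx.2]
  have hmain := card_le_card_connectedComponent_add_card G P hconst
  rw [Fintype.card_fin] at hmain
  omega
end
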